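/- Let N ⊆ M be hyperfinite II₁ factors with N' ∩ M = ℂ1 and let ω be a free ultrafilter on ℕ such that M' ∩ M^ω ⊆ N^ω. Then the central sequence algebras coincide: M' ∩ M^ω = N' ∩ N^ω (as subalgebras of M^ω). -/

import Mathlib

open scoped ComplexOrder
open Filter

namespace PopaQ

variable {H : Type u} [NormedAddCommGroup H] [InnerProductSpace ℂ H] [CompleteSpace H]

/-- Bounded operators on `H`. -/
abbrev Op (H : Type u) [NormedAddCommGroup H] [InnerProductSpace ℂ H] [CompleteSpace H] :=
  H →L[ℂ] H

/-- The relative commutant `N' ∩ M` (as sets of operators). -/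
def relComm (N M : Set (Op H)) : Set (Op H) :=
  {x | x ∈ M ∧ ∀ y ∈ N, y * x = x * y}

/-- The scalar operators `ℂ 1`. -/
def scalars (H : Type u) [NormedAddCommGroup H] [InnerProductSpace ℂ H] [CompleteSpace H] :
    Set (Op H) :=
  {x | ∃ c : ℂ, x = c • (1 : Op H)}

/-- A (self-adjoint) projection. -/
def IsProjection (p : Op H) : Prop :=
  IsSelfAdjoint p ∧ IsIdempotentElem p

/-- `τ` is a faithful tracial state on `M`. -/
structure IsTracialState (M : Set (Op H)) (τ : Op H →ₗ[ℂ] ℂ) : Prop where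
  map_one : τ 1 = 1
  tracial : ∀ x ∈ M, ∀ y ∈ M, τ (x * y) = τ (y * x)
  pos : ∀ x ∈ M, 0 ≤ τ (star x * x)
  faithful : ∀ x ∈ M, τ (star x * x) = 0 → x = 0

/-- A set of operators is finite dimensional as a complex vector space. -/
def FinDim (S : Set (Op H)) : Prop :=
  ∃ s : Finset (Op H), S ⊆ (Submodule.span ℂ (s : Set (Op H)) : Set (Op H))

/-- `M` is a II₁ factor with faithful normal trace `τ`:
a factor (trivial center) carrying a faithful tracial state, which is
infinite dimensional. -/
structure IsII1Factor (M : VonNeumannAlgebra H) (τ : Op H →ₗ[ℂ] ℂ) : Prop where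
  factor : relComm (M : Set (Op H)) (M : Set (Op H)) = scalars H
  trace : IsTracialState (M : Set (Op H)) τ
  infdim : ¬ FinDim (M : Set (Op H))

/-- `M` is hyperfinite: it is the (weak closure = double commutant) of an increasing
union of finite-dimensional *-subalgebras. -/
def IsHyperfinite (M : VonNeumannAlgebra H) : Prop :=
  ∃ A : ℕ → StarSubalgebra ℂ (Op H),
    Monotone A ∧ (∀ n, (A n : Set (Op H)) ⊆ M) ∧ (∀ n, FinDim (A n : Set (Op H))) ∧
    Set.centralizer (Set.centralizer (⋃ n, (A n : Set (Op H)))) = (M : Set (Op H))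

/-- A bounded sequence of operators. -/
def Bdd (x : ℕ → Op H) : Prop :=
  ∃ C : ℝ, ∀ n, ‖x n‖ ≤ C

/-- A sequence taking values in `S`. -/
def SeqIn (S : Set (Op H)) (x : ℕ → Op H) : Prop :=
  ∀ n, x n ∈ S

/-- A free ultrafilter on ℕ. -/
def IsFreeUltrafilter (ω : Ultrafilter ℕ) : Prop :=
  ∀ s : Set ℕ, s.Finite → s ∉ ω

/-- `Mω` is the tracial ultrapower of `M` along `ω`, with trace `τ`;
`limω` assigns to each bounded sequence in `M` its class in `Mω` (the diagonal
embedding of `M` into `Mω` being the identity on `M`). -/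
structure IsTracialUltrapower (ω : Ultrafilter ℕ) (M Mω : VonNeumannAlgebra H)
    (τ : Op H →ₗ[ℂ] ℂ) (limω : (ℕ → Op H) → Op H) : Prop where
  subset : (M : Set (Op H)) ⊆ (Mω : Set (Op H))
  mem : ∀ x, SeqIn (M : Set (Op H)) x → Bdd x → limω x ∈ Mω
  diag : ∀ m ∈ M, limω (fun _ => m) = m
  map_add : ∀ x y, SeqIn (M : Set (Op H)) x → Bdd x → SeqIn (M : Set (Op H)) y → Bdd y →
    limω (fun n => x n + y n) = limω x + limω y
  map_mul : ∀ x y, SeqIn (M : Set (Op H)) x → Bdd x → SeqIn (M : Set (Op H)) y → Bdd y →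
    limω (fun n => x n * y n) = limω x * limω y
  map_smul : ∀ (c : ℂ) x, SeqIn (M : Set (Op H)) x → Bdd x →
    limω (fun n => c • x n) = c • limω x
  map_star : ∀ x, SeqIn (M : Set (Op H)) x → Bdd x →
    limω (fun n => star (x n)) = star (limω x)
  surj : ∀ z ∈ Mω, ∃ x, SeqIn (M : Set (Op H)) x ∧ Bdd x ∧ limω x = z
  tr : ∀ x, SeqIn (M : Set (Op H)) x → Bdd x →
    Tendsto (fun n => τ (x n)) (ω : Filter ℕ) (nhds (τ (limω x)))
  eq_zero : ∀ x, SeqIn (M : Set (Op H)) x → Bdd x →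
    (limω x = 0 ↔ Tendsto (fun n => ‖τ (star (x n) * x n)‖) (ω : Filter ℕ) (nhds 0))
  traceState : IsTracialState (Mω : Set (Op H)) τ

/-- The ultrapower `N^ω ⊆ M^ω` of a subalgebra `N ⊆ M`: classes of bounded
sequences with entries in `N`. -/
def ultrapowerSet (limω : (ℕ → Op H) → Op H) (N : Set (Op H)) : Set (Op H) :=
  {z | ∃ x, SeqIn N x ∧ Bdd x ∧ limω x = z}

/-- `θ` is a *-homomorphism from `S` to `T` (as sets of operators). -/
def IsStarHomOn (θ : Op H → Op H) (S T : Set (Op H)) : Prop :=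
  (∀ x ∈ S, θ x ∈ T) ∧
  (∀ x ∈ S, ∀ y ∈ S, θ (x + y) = θ x + θ y) ∧
  (∀ x ∈ S, ∀ y ∈ S, θ (x * y) = θ x * θ y) ∧
  (∀ (c : ℂ), ∀ x ∈ S, θ (c • x) = c • θ x) ∧
  (∀ x ∈ S, θ (star x) = star (θ x))

/-- The corner `p S p` of a set of operators. -/
def corner (p : Op H) (S : Set (Op H)) : Set (Op H) :=
  {x | x ∈ S ∧ p * x * p = x}

/-- Popa's intertwining relation: a corner of `P` embeds into `Q` inside `M`,
written `P ≺_M Q`: there are nonzero projections `p ∈ P`, `q ∈ Q`, a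
*-homomorphism `θ : pPp → qQq` and a nonzero partial isometry `v ∈ qMp` with
`θ(x) v = v x` for all `x ∈ pPp`. -/
def CornerEmbeds (P Q M : Set (Op H)) : Prop :=
  ∃ (p q v : Op H) (θ : Op H → Op H),
    p ∈ P ∧ IsProjection p ∧ p ≠ 0 ∧
    q ∈ Q ∧ IsProjection q ∧ q ≠ 0 ∧
    IsStarHomOn θ (corner p P) (corner q Q) ∧
    v ∈ M ∧ v ≠ 0 ∧ IsProjection (star v * v) ∧ q * v * p = v ∧
    ∀ x ∈ corner p P, θ x * v = v * x

/-- `E` is the (`τ`-preserving) conditional expectation from `M` onto `Q`. -/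
structure IsCondExp (τ : Op H →ₗ[ℂ] ℂ) (M Q : Set (Op H)) (E : Op H → Op H) : Prop where
  mem : ∀ x ∈ M, E x ∈ Q
  fix : ∀ q ∈ Q, E q = q
  map_add : ∀ x ∈ M, ∀ y ∈ M, E (x + y) = E x + E y
  map_smul : ∀ (c : ℂ), ∀ x ∈ M, E (c • x) = c • E x
  bimod : ∀ a ∈ Q, ∀ x ∈ M, ∀ b ∈ Q, E (a * x * b) = a * E x * b
  tr : ∀ x ∈ M, τ (E x) = τ x

/-- `c` is a Pimsner–Popa bound for the inclusion `Q ⊆ M` with conditional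
expectation `E`: every positive `x ∈ M` satisfies `x ≤ c E(x)`. -/
def IndexBound (M : Set (Op H)) (E : Op H → Op H) (c : ℝ) : Prop :=
  ∀ x ∈ M, x.IsPositive → (c • E x - x).IsPositive

/-- The inclusion `Q ⊆ M` (with conditional expectation `E`) has finite Jones index. -/
def HasFiniteIndex (M : Set (Op H)) (E : Op H → Op H) : Prop :=
  ∃ c : ℝ, 0 < c ∧ IndexBound M E c

/-- The Jones index `[M : Q]` of an inclusion `Q ⊆ M` with conditional expectation `E`,
via the Pimsner–Popa characterization as the optimal constant `c` with
`x ≤ c E(x)` for all positive `x ∈ M`. -/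
noncomputable def jonesIndex (M : Set (Op H)) (E : Op H → Op H) : ℝ :=
  sInf {c : ℝ | 0 < c ∧ IndexBound M E c}

section Basics

lemma mem_of_comm (M : VonNeumannAlgebra H) {x : Op H}
    (h : ∀ y ∈ Set.centralizer (M : Set (Op H)), y * x = x * y) : x ∈ M := by
  have : x ∈ (M : Set (Op H)) := by
    rw [← M.centralizer_centralizer]
    exact fun y hy => h y hy
  exact this

lemma comm_of_mem (M : VonNeumannAlgebra H) {x y : Op H} (hx : x ∈ M)
    (hy : y ∈ Set.centralizer (M : Set (Op H))) : x * y = y * x := hy x hx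

lemma smul_mem' (M : VonNeumannAlgebra H) (c : ℂ) {x : Op H} (hx : x ∈ M) : c • x ∈ M :=
  M.toStarSubalgebra.smul_mem hx c

lemma exists_sqrt (M : VonNeumannAlgebra H) {x : Op H} (hx : x ∈ M) (h0 : 0 ≤ x) :
    ∃ b ∈ M, star b * b = x := by
  refine ⟨CFC.sqrt x, ?_, ?_⟩
  · apply mem_of_comm
    intro y hy
    have : Commute x y := comm_of_mem M hx hy
    exact (this.cfcₙ_nnreal _).eq.symm
  · rw [(IsSelfAdjoint.of_nonneg (CFC.sqrt_nonneg x)).star_eq, CFC.sqrt_mul_sqrt_self x h0]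

lemma inv_mem' (M : VonNeumannAlgebra H) {x y : Op H} (hx : x ∈ M) (h1 : x * y = 1)
    (h2 : y * x = 1) : y ∈ M := by
  apply mem_of_comm
  intro z hz
  have h := comm_of_mem M hx hz
  calc z * y = (y * x) * z * y := by rw [h2, one_mul]
    _ = y * (x * z) * y := by noncomm_ring
    _ = y * z * (x * y) := by rw [h]; noncomm_ring
    _ = y * z := by rw [h1, mul_one]

variable {M : VonNeumannAlgebra H} {τ : Op H →ₗ[ℂ] ℂ}

lemma tr_nonneg (hτ : IsTracialState (M : Set (Op H)) τ) {x : Op H} (hx : x ∈ M) (h0 : 0 ≤ x) :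
    0 ≤ τ x := by
  obtain ⟨b, hb, rfl⟩ := exists_sqrt M hx h0
  exact hτ.pos b hb

lemma tr_mono (hτ : IsTracialState (M : Set (Op H)) τ) {x y : Op H} (hx : x ∈ M) (hy : y ∈ M)
    (h : x ≤ y) : (τ x).re ≤ (τ y).re := by
  have := tr_nonneg hτ (sub_mem hy hx) (sub_nonneg.2 h)
  rw [map_sub] at this
  have := (Complex.le_def.1 this).1
  simp at this
  exact this

/-- squared 2-norm -/
noncomputable def n2 (τ : Op H →ₗ[ℂ] ℂ) (x : Op H) : ℝ := (τ (star x * x)).re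

lemma tr_eq_n2 (hτ : IsTracialState (M : Set (Op H)) τ) {x : Op H} (hx : x ∈ M) :
    τ (star x * x) = (n2 τ x : ℂ) := by
  have := Complex.le_def.1 (hτ.pos x hx)
  apply Complex.ext
  · simp [n2]
  · simpa using this.2.symm

lemma n2_nonneg (hτ : IsTracialState (M : Set (Op H)) τ) {x : Op H} (hx : x ∈ M) :
    0 ≤ n2 τ x := by
  simpa [n2] using (Complex.le_def.1 (hτ.pos x hx)).1

lemma norm_tr (hτ : IsTracialState (M : Set (Op H)) τ) {x : Op H} (hx : x ∈ M) :
    ‖τ (star x * x)‖ = n2 τ x := by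
  rw [tr_eq_n2 hτ hx, Complex.norm_real, Real.norm_of_nonneg (n2_nonneg hτ hx)]

lemma n2_sub_le (hτ : IsTracialState (M : Set (Op H)) τ) {x y : Op H} (hx : x ∈ M) (hy : y ∈ M) :
    n2 τ (x - y) ≤ 2 * n2 τ x + 2 * n2 τ y := by
  have h := n2_nonneg hτ (add_mem hx hy)
  have e : star (x + y) * (x + y) + star (x - y) * (x - y)
      = (2 : ℂ) • (star x * x) + (2 : ℂ) • (star y * y) := by
    simp only [star_add, star_sub, two_smul]; noncomm_ring
  have := congrArg (fun z => (τ z).re) e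
  simp only [map_add, map_smul, Complex.add_re, smul_eq_mul, Complex.mul_re] at this
  simp at this
  unfold n2 at *
  rw [star_add] at h
  rw [star_sub]
  linarith

lemma tr_zero_of_nonneg (hτ : IsTracialState (M : Set (Op H)) τ) {x : Op H} (hx : x ∈ M)
    (h0 : 0 ≤ x) (h : τ x = 0) : x = 0 := by
  obtain ⟨b, hb, rfl⟩ := exists_sqrt M hx h0
  rw [hτ.faithful b hb h]; simp

end Basics

section Ultra

variable {ω : Ultrafilter ℕ} {M Mω : VonNeumannAlgebra H} {τ : Op H →ₗ[ℂ] ℂ}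
  {limω : (ℕ → Op H) → Op H}

lemma free_le (hω : IsFreeUltrafilter ω) : (ω : Filter ℕ) ≤ atTop := by
  rw [← Nat.cofinite_eq_atTop]
  intro s hs
  by_contra h
  have := Ultrafilter.compl_mem_iff_notMem.2 h
  exact hω _ hs this

lemma trM (hU : IsTracialUltrapower ω M Mω τ limω) : IsTracialState (M : Set (Op H)) τ where
  map_one := hU.traceState.map_one
  tracial x hx y hy := hU.traceState.tracial x (hU.subset hx) y (hU.subset hy)
  pos x hx := hU.traceState.pos x (hU.subset hx)
  faithful x hx := hU.traceState.faithful x (hU.subset hx)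

lemma Bdd.add {x y : ℕ → Op H} (hx : Bdd x) (hy : Bdd y) : Bdd (fun n => x n + y n) := by
  obtain ⟨C, hC⟩ := hx
  obtain ⟨D, hD⟩ := hy
  exact ⟨C + D, fun n => (norm_add_le _ _).trans (add_le_add (hC n) (hD n))⟩

lemma Bdd.mul {x y : ℕ → Op H} (hx : Bdd x) (hy : Bdd y) : Bdd (fun n => x n * y n) := by
  obtain ⟨C, hC⟩ := hx
  obtain ⟨D, hD⟩ := hy
  exact ⟨C * D, fun n => (norm_mul_le _ _).trans
    (mul_le_mul (hC n) (hD n) (norm_nonneg _) ((norm_nonneg _).trans (hC n)))⟩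

lemma Bdd.smul {x : ℕ → Op H} (c : ℂ) (hx : Bdd x) : Bdd (fun n => c • x n) := by
  obtain ⟨C, hC⟩ := hx
  exact ⟨‖c‖ * C, fun n => by
    rw [norm_smul]; exact mul_le_mul_of_nonneg_left (hC n) (norm_nonneg _)⟩

lemma Bdd.star {x : ℕ → Op H} (hx : Bdd x) : Bdd (fun n => star (x n)) := by
  obtain ⟨C, hC⟩ := hx
  exact ⟨C, fun n => by rw [norm_star]; exact hC n⟩

lemma Bdd.const (a : Op H) : Bdd (fun _ => a) := ⟨‖a‖, fun _ => le_rfl⟩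

lemma Bdd.sub {x y : ℕ → Op H} (hx : Bdd x) (hy : Bdd y) : Bdd (fun n => x n - y n) := by
  obtain ⟨C, hC⟩ := hx
  obtain ⟨D, hD⟩ := hy
  exact ⟨C + D, fun n => (norm_sub_le _ _).trans (add_le_add (hC n) (hD n))⟩

lemma lim_sub (hU : IsTracialUltrapower ω M Mω τ limω) {x y : ℕ → Op H}
    (hx : SeqIn (M : Set (Op H)) x) (bx : Bdd x) (hy : SeqIn (M : Set (Op H)) y) (by' : Bdd y) :
    limω (fun n => x n - y n) = limω x - limω y := by
  have h1 := hU.map_smul (-1) y hy by'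
  have h2 := hU.map_add x (fun n => (-1 : ℂ) • y n) hx bx
    (fun n => smul_mem' M _ (hy n)) (by'.smul _)
  rw [h1] at h2
  simp only [neg_smul, one_smul, ← sub_eq_add_neg] at h2
  exact h2

lemma lim_eq_of (hU : IsTracialUltrapower ω M Mω τ limω) {x y : ℕ → Op H}
    (hx : SeqIn (M : Set (Op H)) x) (bx : Bdd x) (hy : SeqIn (M : Set (Op H)) y) (by' : Bdd y)
    (h : ∀ᶠ n in (ω : Filter ℕ), x n = y n) : limω x = limω y := by
  rw [← sub_eq_zero, ← lim_sub hU hx bx hy by',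
    hU.eq_zero _ (fun n => sub_mem (hx n) (hy n)) (bx.sub by')]
  refine tendsto_const_nhds.congr' ?_
  filter_upwards [h] with n hn
  simp [hn]

lemma lim_nonneg (hU : IsTracialUltrapower ω M Mω τ limω) {x : ℕ → Op H}
    (hx : SeqIn (M : Set (Op H)) x) (bx : Bdd x) (h : ∀ n, 0 ≤ x n) : 0 ≤ limω x := by
  choose b hb hbx using fun n => exists_sqrt M (hx n) (h n)
  have bb : Bdd b := by
    obtain ⟨C, hC⟩ := bx
    refine ⟨C + 1, fun n => ?_⟩
    have h1 := hC n
    rw [← hbx, CStarRing.norm_star_mul_self] at h1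
    nlinarith [sq_nonneg (‖b n‖ - 1), norm_nonneg (b n)]
  have h1 := hU.map_mul (fun n => star (b n)) b (fun n => star_mem (hb n)) bb.star hb bb
  rw [hU.map_star b hb bb] at h1
  simp only [hbx] at h1
  rw [h1]
  exact star_mul_self_nonneg _

lemma star_mul_le_of_norm {z : Op H} {c : ℝ} (h : ‖z‖ ≤ c) :
    star z * z ≤ ((c ^ 2 : ℝ) : ℂ) • (1 : Op H) := by
  refine (CStarAlgebra.star_mul_le_algebraMap_norm_sq (a := z)).trans ?_
  have h2 : ‖z‖ ^ 2 ≤ c ^ 2 := by gcongr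
  rw [Algebra.algebraMap_eq_smul_one, ← Complex.coe_smul]
  rw [← sub_nonneg, ← sub_smul, ← Complex.ofReal_sub]
  rw [Complex.coe_smul]
  exact smul_nonneg (sub_nonneg.2 h2) zero_le_one

lemma norm_le_of_star_mul {z : Op H} {c : ℝ} (hc : 0 ≤ c)
    (h : star z * z ≤ ((c ^ 2 : ℝ) : ℂ) • (1 : Op H)) : ‖z‖ ≤ c := by
  have h1 := CStarAlgebra.norm_le_norm_of_nonneg_of_le (star_mul_self_nonneg z) h
  rw [CStarRing.norm_star_mul_self, norm_smul] at h1
  have h2 : ‖(1 : Op H)‖ ≤ 1 := ContinuousLinearMap.norm_id_le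
  have h3 : ‖((c ^ 2 : ℝ) : ℂ)‖ = c ^ 2 := by
    rw [Complex.norm_real, Real.norm_of_nonneg (sq_nonneg c)]
  rw [h3] at h1
  have : ‖z‖ ^ 2 ≤ c ^ 2 := by nlinarith [sq_nonneg c]
  exact le_of_sq_le_sq this hc

lemma norm_lim_le (hU : IsTracialUltrapower ω M Mω τ limω) {x : ℕ → Op H}
    (hx : SeqIn (M : Set (Op H)) x) (bx : Bdd x) {c : ℝ} (hc : 0 ≤ c)
    (h : ∀ᶠ n in (ω : Filter ℕ), ‖x n‖ ≤ c) : ‖limω x‖ ≤ c := by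
  classical
  set y : ℕ → Op H := fun n => if ‖x n‖ ≤ c then x n else 0 with hy
  have yM : SeqIn (M : Set (Op H)) y := fun n => by
    simp only [hy]; split_ifs
    · exact hx n
    · exact zero_mem M
  have yc : ∀ n, ‖y n‖ ≤ c := fun n => by
    simp only [hy]; split_ifs with h
    · exact h
    · simpa using hc
  have yb : Bdd y := ⟨c, yc⟩
  have e : limω x = limω y := lim_eq_of hU hx bx yM yb (by
    filter_upwards [h] with n hn
    simp [hy, hn])
  rw [e]
  apply norm_le_of_star_mul hc
  have m1 : SeqIn (M : Set (Op H)) (fun _ : ℕ => ((c ^ 2 : ℝ) : ℂ) • (1 : Op H)) :=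
    fun _ => smul_mem' M _ (one_mem M)
  have m2 : SeqIn (M : Set (Op H)) (fun n => star (y n) * y n) :=
    fun n => mul_mem (star_mem (yM n)) (yM n)
  have h1 := lim_nonneg hU (x := fun n => ((c ^ 2 : ℝ) : ℂ) • (1 : Op H) - star (y n) * y n)
    (fun n => sub_mem (m1 n) (m2 n)) ((Bdd.const _).sub (yb.star.mul yb))
    (fun n => sub_nonneg.2 (star_mul_le_of_norm (yc n)))
  rw [lim_sub hU m1 (Bdd.const _) m2 (yb.star.mul yb),
    hU.map_mul _ _ (fun n => star_mem (yM n)) yb.star yM yb, hU.map_star y yM yb,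
    hU.diag _ (m1 0)] at h1
  exact sub_nonneg.1 h1

end Ultra

section LemmaA

variable {ω : Ultrafilter ℕ} {M Mω : VonNeumannAlgebra H} {τ : Op H →ₗ[ℂ] ℂ}
  {limω : (ℕ → Op H) → Op H}

lemma resolvent (hτ : IsTracialState (M : Set (Op H)) τ) {S : Op H} (hS : S ∈ M) (h0 : 0 ≤ S) :
    ∃ g ∈ M, star g = g ∧ ‖g‖ ≤ 1 ∧ n2 τ (1 - g) ≤ (τ S).re ∧
      ∀ (d : Op H) (c : ℝ), 0 < c → ((c ^ 2 : ℝ) : ℂ) • (star d * d) ≤ S → ‖d * g‖ ≤ 1 / c := by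
  have hu : IsUnit (1 + S) :=
    CStarAlgebra.isUnit_of_le 1 (le_add_of_nonneg_right h0) isStrictlyPositive_one
  obtain ⟨u, hu⟩ := hu
  set g : Op H := ↑u⁻¹ with hg
  have h1 : (1 + S) * g = 1 := by rw [← hu]; simp [hg]
  have h2 : g * (1 + S) = 1 := by rw [← hu]; simp [hg]
  have gM : g ∈ M := inv_mem' M (add_mem (one_mem M) hS) h1 h2
  have Ssa : star S = S := (IsSelfAdjoint.of_nonneg h0).star_eq
  have gsa : star g = g := by
    have h3 : star g * (1 + S) = 1 := by
      have := congrArg star h1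
      simpa [Ssa] using this
    calc star g = star g * ((1 + S) * g) := by rw [h1, mul_one]
      _ = (star g * (1 + S)) * g := by rw [mul_assoc]
      _ = g := by rw [h3, one_mul]
  have Sg : S * g = 1 - g := by rw [← h1]; noncomm_ring
  have gS : g * S = 1 - g := by rw [← h2]; noncomm_ring
  have c1 : 0 ≤ g * g := by simpa [gsa] using star_mul_self_nonneg g
  have c2 : 0 ≤ g * S * g := by simpa [gsa] using star_left_conjugate_nonneg h0 g
  have c3 : 0 ≤ (1 - g) * (1 - g) := by
    simpa [gsa] using star_mul_self_nonneg (1 - g)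
  have e2 : g * S * g = g - g * g := by rw [gS]; noncomm_ring
  have g0 : 0 ≤ g := by
    have : g = g * g + g * S * g := by rw [e2]; noncomm_ring
    rw [this]; exact add_nonneg c1 c2
  have g1 : g ≤ 1 := by
    rw [← sub_nonneg]
    have : 1 - g = g * S * g + (1 - g) * (1 - g) := by rw [e2]; noncomm_ring
    rw [this]; exact add_nonneg c2 c3
  have sgs : (1 - g) * (1 - g) ≤ S := by
    have a1 : 0 ≤ S * g * S := by simpa [Ssa] using star_left_conjugate_nonneg g0 S
    have a2 : S = (1 - g) * (1 - g) + g * S * g + S * g * S := by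
      rw [e2, Sg, sub_mul 1 g S, gS]; noncomm_ring
    have a3 : S - (1 - g) * (1 - g) = g * S * g + S * g * S := by
      nth_rw 1 [a2]; noncomm_ring
    rw [← sub_nonneg, a3]; exact add_nonneg c2 a1
  have omM : (1 - g) ∈ M := sub_mem (one_mem M) gM
  refine ⟨g, gM, gsa, (CStarAlgebra.norm_le_one_iff_of_nonneg g g0).2 g1, ?_, ?_⟩
  · unfold n2
    have : star (1 - g) = 1 - g := by simp [gsa]
    rw [this]
    exact tr_mono hτ (mul_mem omM omM) hS sgs
  · intro d c hc hd
    apply norm_le_of_star_mul (by positivity)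
    have k1 : star g * (((c ^ 2 : ℝ) : ℂ) • (star d * d)) * g ≤ star g * S * g :=
      star_left_conjugate_le_conjugate hd g
    have k2 : star g * S * g ≤ 1 := by
      rw [gsa, e2]; exact (sub_le_self _ c1).trans g1
    have k3 := k1.trans k2
    have k4 : star g * (((c ^ 2 : ℝ) : ℂ) • (star d * d)) * g
        = ((c ^ 2 : ℝ) : ℂ) • (star (d * g) * (d * g)) := by
      simp only [star_mul, mul_smul_comm, smul_mul_assoc, mul_assoc]
    rw [k4] at k3
    rw [Complex.coe_smul] at k3 ⊢
    have k5 := smul_le_smul_of_nonneg_left k3 (show (0 : ℝ) ≤ (1 / c) ^ 2 by positivity)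
    rw [smul_smul] at k5
    have : (1 / c) ^ 2 * c ^ 2 = 1 := by field_simp
    rwa [this, one_smul] at k5

lemma geom_le (n m : ℕ) : ∑ i ∈ Finset.Ico n m, (1 / 2 : ℝ) ^ i ≤ 2 * (1 / 2) ^ n := by
  rcases le_total n m with h | h
  · have : ∑ i ∈ Finset.Ico n m, (1 / 2 : ℝ) ^ i = 2 * (1 / 2) ^ n - 2 * (1 / 2) ^ m := by
      induction m, h using Nat.le_induction with
      | base => simp
      | succ m h ih => rw [Finset.sum_Ico_succ_top h, ih, pow_succ]; ring
    rw [this]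
    have : (0 : ℝ) ≤ (1 / 2) ^ m := by positivity
    linarith
  · rw [Finset.Ico_eq_empty_of_le h]; simp

lemma ker_proj_mem (K : Submodule ℂ H) [K.HasOrthogonalProjection] (Q : VonNeumannAlgebra H)
    (h : ∀ y ∈ Q.commutant, ∀ v ∈ K, y v ∈ K) : K.starProjection ∈ Q := by
  rw [VonNeumannAlgebra.IsStarProjection.mem_iff (by exact isStarProjection_starProjection)]
  intro y hy
  rw [Module.End.mem_invtSubmodule]
  intro v hv
  have e : LinearMap.range (K.starProjection : H →ₗ[ℂ] H) = K := by
    exact Submodule.range_starProjection K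
  rw [e] at hv
  rw [Submodule.mem_comap, e]
  exact h y hy v hv

lemma n2_conj_le (hτ : IsTracialState (Mω : Set (Op H)) τ) {p a : Op H} (hp : p ∈ Mω)
    (ha : a ∈ Mω) (hps : star p = p) (hpp : p * p = p) (h : p = a * p) :
    (τ p).re ≤ n2 τ a := by
  have e : p = star p * (star a * a) * p := by
    calc p = star p * p := by rw [hps, hpp]
      _ = star (a * p) * (a * p) := by rw [← h]
      _ = _ := by simp only [star_mul, mul_assoc]
  have p1 : p ≤ 1 := by
    rw [← sub_nonneg]
    have : 1 - p = star (1 - p) * (1 - p) := by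
      simp only [star_sub, star_one, hps, mul_sub, sub_mul, hpp, mul_one, one_mul]; abel
    rw [this]; exact star_mul_self_nonneg _
  have t1 : τ p = τ (a * p * star a) := by
    nth_rw 1 [e]
    rw [mul_assoc, hτ.tracial (star p) (star_mem hp) _ (mul_mem (mul_mem (star_mem ha) ha) hp)]
    have : star a * a * p * star p = star a * (a * p) := by
      rw [hps, mul_assoc, mul_assoc, hpp]
    rw [this]
    rw [hτ.tracial _ (star_mem ha) _ (mul_mem ha hp)]
  have t2 : a * p * star a ≤ a * 1 * star a := star_right_conjugate_le_conjugate p1 a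
  rw [t1]
  refine (tr_mono hτ (mul_mem (mul_mem ha hp) (star_mem ha))
    (mul_mem (mul_mem ha (one_mem _)) (star_mem ha)) t2).trans ?_
  rw [mul_one, hτ.tracial _ ha _ (star_mem ha)]
  rfl

lemma dense_conv {x : ℕ → Op H} {y : Op H} {C : ℝ} (hx : ∀ n, ‖x n‖ ≤ C) (D : Set H)
    (hD : ∀ v, (∀ d ∈ D, inner ℂ d v = 0) → v = 0)
    (hc : ∀ d ∈ D, Tendsto (fun n => x n d) atTop (nhds (y d))) (ζ : H) :
    Tendsto (fun n => x n ζ) atTop (nhds (y ζ)) := by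
  set E : Submodule ℂ H :=
    { carrier := {v | Tendsto (fun n => x n v) atTop (nhds (y v))}
      add_mem' := fun {a b} ha hb => by
        simp only [Set.mem_ofPred_eq, map_add] at *
        exact ha.add hb
      zero_mem' := by simp
      smul_mem' := fun c v hv => by
        simp only [Set.mem_ofPred_eq, map_smul] at *
        exact hv.const_smul c } with hE
  have hperp : Eᗮ = ⊥ := by
    rw [Submodule.eq_bot_iff]
    intro v hv
    exact hD v fun d hd => (Submodule.mem_orthogonal _ _).1 hv d (hc d hd)
  have hdense := (Submodule.topologicalClosure_eq_top_iff (K := E)).2 hperp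
  have hζ : ζ ∈ closure (E : Set H) := by
    rw [← Submodule.topologicalClosure_coe, hdense]; trivial
  rw [Metric.tendsto_atTop]
  intro ε hε
  have hC : 0 ≤ C := (norm_nonneg _).trans (hx 0)
  obtain ⟨v, hv, hvd⟩ := Metric.mem_closure_iff.1 hζ (ε / (2 * (C + ‖y‖ + 1))) (by positivity)
  have hv' : Tendsto (fun n => x n v) atTop (nhds (y v)) := hv
  obtain ⟨n0, hn0⟩ := Metric.tendsto_atTop.1 hv' (ε / 2) (by positivity)
  refine ⟨n0, fun n hn => ?_⟩
  have h1 := hn0 n hn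
  rw [dist_eq_norm] at h1 hvd ⊢
  have e : x n ζ - y ζ = x n (ζ - v) - y (ζ - v) + (x n v - y v) := by simp only [map_sub]; abel
  have b1 : ‖x n (ζ - v)‖ ≤ C * ‖ζ - v‖ := (x n).le_of_opNorm_le (hx n) _
  have b2 : ‖y (ζ - v)‖ ≤ ‖y‖ * ‖ζ - v‖ := y.le_opNorm _
  have b3 : (C + ‖y‖ + 1) * ‖ζ - v‖ < ε / 2 := by
    have hpos : 0 < C + ‖y‖ + 1 := by positivity
    rw [lt_div_iff₀ (by positivity)] at hvd
    linarith
  have b4 : 0 ≤ ‖ζ - v‖ := norm_nonneg _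
  rw [e]
  calc _ ≤ ‖x n (ζ - v) - y (ζ - v)‖ + ‖x n v - y v‖ := norm_add_le _ _
    _ ≤ ‖x n (ζ - v)‖ + ‖y (ζ - v)‖ + ‖x n v - y v‖ := by gcongr; exact norm_sub_le _ _
    _ < ε := by nlinarith

end LemmaA

section LemmaA2

variable {ω : Ultrafilter ℕ} {M Mω : VonNeumannAlgebra H} {τ : Op H →ₗ[ℂ] ℂ}
  {limω : (ℕ → Op H) → Op H}

lemma lemmaA (hω : IsFreeUltrafilter ω) (hU : IsTracialUltrapower ω M Mω τ limω) {x : ℕ → Op H}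
    (hx : SeqIn (M : Set (Op H)) x) {C : ℝ} (hC : ∀ n, ‖x n‖ ≤ C)
    (hfast : ∀ n, n2 τ (x (n + 1) - x n) ≤ (1 / 8) ^ n) (ζ : H) :
    Tendsto (fun n => x n ζ) atTop (nhds (limω x ζ)) := by
  have hτ := trM hU
  have bx : Bdd x := ⟨C, hC⟩
  set z : ℕ → Op H := fun n => x (n + 1) - x n with hz
  have zM : ∀ n, z n ∈ M := fun n => sub_mem (hx _) (hx _)
  set S : ℕ → ℕ → Op H := fun k m =>
    ∑ i ∈ Finset.Ico k m, (((2 ^ i) ^ 2 : ℝ) : ℂ) • (star (z i) * z i) with hS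
  have wM : ∀ i, (((2 ^ i) ^ 2 : ℝ) : ℂ) • (star (z i) * z i) ∈ M :=
    fun i => smul_mem' M _ (mul_mem (star_mem (zM i)) (zM i))
  have w0 : ∀ i, 0 ≤ (((2 ^ i) ^ 2 : ℝ) : ℂ) • (star (z i) * z i) := fun i => by
    rw [Complex.coe_smul]
    exact smul_nonneg (by positivity) (star_mul_self_nonneg _)
  have SM : ∀ k m, S k m ∈ M := fun k m => sum_mem fun i _ => wM i
  have S0 : ∀ k m, 0 ≤ S k m := fun k m => Finset.sum_nonneg fun i _ => w0 i
  have St : ∀ k m, (τ (S k m)).re ≤ 2 * (1 / 2) ^ k := fun k m => by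
    refine le_trans ?_ (geom_le k m)
    simp only [hS, map_sum, Complex.re_sum]
    refine Finset.sum_le_sum fun i _ => ?_
    rw [map_smul, smul_eq_mul, Complex.re_ofReal_mul]
    have h1 : (τ (star (z i) * z i)).re ≤ (1 / 8) ^ i := hfast i
    calc _ ≤ ((2 : ℝ) ^ i) ^ 2 * (1 / 8) ^ i := by gcongr
      _ = (1 / 2) ^ i := by rw [← pow_mul, mul_comm i 2, pow_mul, ← mul_pow]; norm_num
  choose g gM gsa g1 gn gd using fun k m => resolvent hτ (SM k m) (S0 k m)
  have gb : ∀ k, Bdd (g k) := fun k => ⟨1, g1 k⟩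
  set y : ℕ → Op H := fun k => limω (g k) with hy
  have yM : ∀ k, y k ∈ Mω := fun k => hU.mem _ (gM k) (gb k)
  have ysa : ∀ k, star (y k) = y k := fun k => by
    have := hU.map_star (g k) (gM k) (gb k)
    simp only [gsa] at this
    exact this.symm
  have key : ∀ k n, k ≤ n → ‖(limω x - x n) * y k‖ ≤ 2 * (1 / 2) ^ n := by
    intro k n hkn
    have mn : SeqIn (M : Set (Op H)) (fun _ : ℕ => x n) := fun _ => hx n
    have e : (limω x - x n) * y k = limω (fun m => (x m - x n) * g k m) := by
      rw [hU.map_mul _ _ (fun m => sub_mem (hx m) (hx n)) (bx.sub (Bdd.const _)) (gM k) (gb k),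
        lim_sub hU hx bx mn (Bdd.const _), hU.diag _ (hx n)]
    rw [e]
    apply norm_lim_le hU (fun m => mul_mem (sub_mem (hx m) (hx n)) (gM k m))
      ((bx.sub (Bdd.const _)).mul (gb k)) (by positivity)
    filter_upwards [free_le hω (eventually_ge_atTop n)] with m hm
    have tel : x m - x n = ∑ i ∈ Finset.Ico n m, z i := by
      rw [Finset.sum_Ico_sub x hm]
    rw [tel, Finset.sum_mul]
    refine (norm_sum_le _ _).trans (le_trans ?_ (geom_le n m))
    refine Finset.sum_le_sum fun i hi => ?_
    rw [Finset.mem_Ico] at hi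
    have h := gd k m (z i) (2 ^ i) (by positivity) (by
      exact Finset.single_le_sum (f := fun i => (((2 ^ i) ^ 2 : ℝ) : ℂ) • (star (z i) * z i))
        (fun i _ => w0 i) (Finset.mem_Ico.2 ⟨hkn.trans hi.1, hi.2⟩))
    rw [one_div_pow]; exact h
  have ny : ∀ k, n2 τ (1 - y k) ≤ 2 * (1 / 2) ^ k := by
    intro k
    have m1 : SeqIn (M : Set (Op H)) (fun _ : ℕ => (1 : Op H)) := fun _ => one_mem M
    have m2 : SeqIn (M : Set (Op H)) (fun m => 1 - g k m) :=
      fun m => sub_mem (one_mem M) (gM k m)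
    have b2 : Bdd (fun m => 1 - g k m) := (Bdd.const _).sub (gb k)
    have e : limω (fun m => star (1 - g k m) * (1 - g k m)) = star (1 - y k) * (1 - y k) := by
      rw [hU.map_mul _ _ (fun m => star_mem (m2 m)) b2.star m2 b2, hU.map_star _ m2 b2,
        lim_sub hU m1 (Bdd.const _) (gM k) (gb k), hU.diag _ (one_mem M)]
    have t := hU.tr _ (fun m => mul_mem (star_mem (m2 m)) (m2 m)) (b2.star.mul b2)
    rw [e] at t
    have t' := (Complex.continuous_re.tendsto _).comp t
    exact le_of_tendsto t' (Eventually.of_forall fun m => (gn k m).trans (St k m))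
  have hker : ∀ v, (∀ k, y k v = 0) → v = 0 := by
    set K : Submodule ℂ H := ⨅ k, LinearMap.ker (y k : H →ₗ[ℂ] H) with hK
    have memK : ∀ v, v ∈ K ↔ ∀ k, y k v = 0 := fun v => by simp [hK, Submodule.mem_iInf]
    have Kc : IsClosed (K : Set H) := by
      have : (K : Set H) = ⋂ k, {v | y k v = 0} := by
        ext v; simp [memK]
      rw [this]
      exact isClosed_iInter fun k => isClosed_eq (y k).continuous continuous_const
    have : CompleteSpace K := Kc.completeSpace_coe
    set p : Op H := K.starProjection with hp
    have pM : p ∈ Mω := by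
      apply ker_proj_mem
      intro t ht v hv
      rw [memK] at hv ⊢
      intro k
      have hc := (VonNeumannAlgebra.mem_commutant_iff.1 ht) (y k) (yM k)
      have := congrArg (fun T : Op H => T v) hc
      simp only [mul_apply_eq_comp, hv k, map_zero] at this
      exact this
    have hsp : IsStarProjection p := isStarProjection_starProjection
    have yp : ∀ k, y k * p = 0 := fun k => by
      ext v
      have : p v ∈ K := K.starProjection_apply_mem v
      exact (memK _).1 this k
    have tp : (τ p).re ≤ 0 := by
      have hlim : Tendsto (fun k : ℕ => 2 * (1 / 2 : ℝ) ^ k) atTop (nhds (2 * 0)) :=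
        (tendsto_pow_atTop_nhds_zero_of_lt_one (by norm_num) (by norm_num)).const_mul 2
      rw [mul_zero] at hlim
      refine ge_of_tendsto' hlim fun k => ?_
      refine (n2_conj_le hU.traceState pM (sub_mem (one_mem _) (yM k)) hsp.isSelfAdjoint.star_eq
        hsp.isIdempotentElem.eq ?_).trans (ny k)
      rw [sub_mul, yp, one_mul, sub_zero]
    have p0 : p = 0 := by
      have h1 : τ (star p * p) = 0 := by
        rw [tr_eq_n2 hU.traceState pM]
        have h2 := n2_nonneg hU.traceState pM
        have h3 : n2 τ p = (τ p).re := by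
          unfold n2; rw [hsp.isSelfAdjoint.star_eq, hsp.isIdempotentElem.eq]
        rw [h3] at h2 ⊢
        rw [le_antisymm tp h2]; simp
      exact hU.traceState.faithful p pM h1
    intro v hv
    have := K.starProjection_eq_self_iff.2 ((memK v).2 hv)
    rw [← hp, p0] at this
    simpa using this.symm
  refine dense_conv hC {d | ∃ k v, d = y k v} ?_ ?_ ζ
  · intro v hv
    apply hker
    intro k
    have h1 := hv (y k (y k v)) ⟨k, y k v, rfl⟩
    have h2 : inner ℂ (y k (y k v)) v = inner ℂ (y k v) (y k v) := by
      have h3 := ContinuousLinearMap.adjoint_inner_left (y k) v (y k v)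
      rw [← ContinuousLinearMap.star_eq_adjoint, ysa k] at h3
      exact h3
    rw [h2, inner_self_eq_zero] at h1
    exact h1
  · rintro d ⟨k, v, rfl⟩
    rw [tendsto_iff_norm_sub_tendsto_zero]
    have hlim : Tendsto (fun n : ℕ => (2 * (1 / 2 : ℝ) ^ n) * ‖v‖) atTop (nhds (2 * 0 * ‖v‖)) :=
      ((tendsto_pow_atTop_nhds_zero_of_lt_one (by norm_num) (by norm_num)).const_mul 2).mul_const _
    rw [mul_zero, zero_mul] at hlim
    refine squeeze_zero' (Eventually.of_forall fun _ => norm_nonneg _) ?_ hlim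
    filter_upwards [eventually_ge_atTop k] with n hn
    have h1 := ((limω x - x n) * y k).le_of_opNorm_le (key k n hn) v
    rw [norm_sub_rev]
    exact h1

end LemmaA2

section Avg

lemma s1 {ω : Ultrafilter ℕ} {M Mω : VonNeumannAlgebra H} {τ : Op H →ₗ[ℂ] ℂ}
    {limω : (ℕ → Op H) → Op H} (hω : IsFreeUltrafilter ω)
    (hU : IsTracialUltrapower ω M Mω τ limω) (ζ : H) (C : ℝ) {δ : ℝ} (hδ : 0 < δ) :
    ∃ ε > 0, ∀ x ∈ M, ‖x‖ ≤ C → n2 τ x ≤ ε → ‖x ζ‖ ≤ δ := by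
  by_contra! hcon
  have hτ := trM hU
  choose x xM xC xn xδ using fun n : ℕ => hcon ((1 / 8) ^ n / 4) (by positivity)
  have bx : Bdd x := ⟨C, xC⟩
  have hlim : limω x = 0 := by
    rw [hU.eq_zero x xM bx]
    have h8 : Tendsto (fun n : ℕ => (1 / 8 : ℝ) ^ n / 4) atTop (nhds (0 / 4)) :=
      (tendsto_pow_atTop_nhds_zero_of_lt_one (by norm_num) (by norm_num)).div_const 4
    rw [zero_div] at h8
    refine squeeze_zero (fun _ => norm_nonneg _) (fun n => ?_) (h8.mono_left (free_le hω))
    rw [norm_tr hτ (xM n)]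
    exact xn n
  have h := lemmaA hω hU xM xC (fun n => by
    have h1 := n2_sub_le hτ (xM (n + 1)) (xM n)
    have h2 := xn n
    have h3 := xn (n + 1)
    have h4 : (0 : ℝ) < (1 / 8) ^ n := by positivity
    rw [pow_succ] at h3
    linarith) ζ
  rw [hlim] at h
  have h2 := h.norm
  simp only [zero_apply, norm_zero] at h2
  have := ge_of_tendsto' h2 (fun n => (xδ n).le)
  linarith

open MeasureTheory

lemma exists_avg_aux {A : Type*} [CStarAlgebra A] [FiniteDimensional ℂ A] (ι : A →⋆ₐ[ℂ] Op H) :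
    ∃ Φ : Op H →ₗ[ℂ] Op H,
      (∀ (X Y : Op H) (ζ : H) (c : ℝ), (∀ v ∈ unitary A,
        ‖(ι v * X * star (ι v)) ζ - Y ζ‖ ≤ c) → ‖Φ X ζ - Y ζ‖ ≤ c) ∧
      (∀ X b, ι b * Φ X = Φ X * ι b) ∧
      (∃ (n : ℕ) (e b : Fin n → A), (∀ X, Φ X = ∑ i, ι (e i) * X * ι (b i)) ∧
        ∑ i, b i * e i = 1) ∧
      (∀ (k : ℕ) (a x y : Fin k → Op H) (c : Op H), (∀ u ∈ unitary A,
        ∑ i, a i * (ι u * x i * star (ι u)) = c * ∑ i, a i * (ι u * y i * star (ι u))) →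
        ∑ i, a i * Φ (x i) = c * ∑ i, a i * Φ (y i)) := by
  have : ProperSpace A := FiniteDimensional.proper ℂ A
  have hcomp : IsCompact (unitary A : Set A) := by
    refine Metric.isCompact_of_isClosed_isBounded isClosed_unitary ?_
    refine (Metric.isBounded_closedBall (x := (0 : A)) (r := 1)).subset fun v hv => ?_
    rw [mem_closedBall_zero_iff]
    have h1 : ‖v‖ * ‖v‖ = ‖(1 : A)‖ := by
      rw [← CStarRing.norm_star_mul_self, (Unitary.mem_iff.1 hv).1]
    have h2 : ‖(1 : A)‖ * ‖(1 : A)‖ = ‖(1 : A)‖ := by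
      rw [← CStarRing.norm_star_mul_self, star_one, one_mul]
    nlinarith [norm_nonneg v, norm_nonneg (1 : A), sq_nonneg (‖v‖ - 1), sq_nonneg (‖(1 : A)‖ - 1)]
  have : CompactSpace (unitary A) := isCompact_iff_compactSpace.1 hcomp
  let _ : MeasurableSpace (unitary A) := borel _
  have : BorelSpace (unitary A) := ⟨rfl⟩
  set μ : Measure (unitary A) := Measure.haarMeasure ⊤ with hμ
  have : IsProbabilityMeasure μ := ⟨by
    have := Measure.haarMeasure_self (G := unitary A) (K₀ := ⊤)
    simpa using this⟩
  set ιL : A →L[ℂ] Op H := LinearMap.toContinuousLinearMap ι.toAlgHom.toLinearMap with hιL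
  have ιc : Continuous ι := ιL.continuous
  have ιL' : ∀ a, ιL a = ι a := fun _ => rfl
  have fc : ∀ X, Continuous fun v : unitary A => ι v * X * star (ι v) := fun X => by
    have : Continuous fun v : unitary A => ι v := ιc.comp continuous_subtype_val
    exact (this.mul continuous_const).mul this.star
  have int : ∀ {E : Type u} [NormedAddCommGroup E] {f : unitary A → E},
      Continuous f → Integrable f μ := fun hf =>
    hf.integrable_of_hasCompactSupport (HasCompactSupport.of_compactSpace _)
  have cml : ∀ (a : Op H) {f : unitary A → Op H}, Continuous f → Continuous fun v => a * f v :=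
    fun a f hf => continuous_const.mul hf
  have cmr : ∀ (a : A) {f : unitary A → A}, Continuous f → Continuous fun v => f v * a :=
    fun a f hf => hf.mul continuous_const
  have intA : ∀ {f : unitary A → A}, Continuous f → Integrable f μ := fun hf =>
    hf.integrable_of_hasCompactSupport (HasCompactSupport.of_compactSpace _)
  let Φ : Op H →ₗ[ℂ] Op H :=
    { toFun := fun X => ∫ v : unitary A, ι v * X * star (ι v) ∂μ
      map_add' := fun X Y => by
        rw [← integral_add (int (fc X)) (int (fc Y))]
        simp only [mul_add, add_mul]
      map_smul' := fun c X => by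
        simp only [RingHom.id_apply]
        rw [← integral_smul]
        simp only [mul_smul_comm, smul_mul_assoc] }
  have Φd : ∀ X, Φ X = ∫ v : unitary A, ι v * X * star (ι v) ∂μ := fun _ => rfl
  refine ⟨Φ, ?_, ?_, ?_, ?_⟩
  · intro X Y ζ c h
    have hc : Continuous fun v : unitary A => (ι v * X * star (ι v)) ζ := by
      exact (ContinuousLinearMap.apply ℂ H ζ).continuous.comp (fc X)
    rw [Φd, ContinuousLinearMap.integral_apply (int (fc X))]
    have e : Y ζ = ∫ v : unitary A, Y ζ ∂μ := by simp
    rw [e, ← integral_sub (int hc) (int continuous_const)]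
    have := norm_integral_le_of_norm_le_const (μ := μ)
      (f := fun v : unitary A => (ι v * X * star (ι v)) ζ - Y ζ) (C := c)
      (Eventually.of_forall fun v => h v v.2)
    simpa using this
  · intro X
    have inv : ∀ w : unitary A, ι w * Φ X = Φ X * ι w := by
      intro w
      have h1 : ι w * Φ X * star (ι w) = Φ X := by
        rw [Φd, ← integral_const_mul_of_integrable (int (fc X)),
          ← integral_mul_const_of_integrable (int (cml _ (fc X)))]
        have := integral_mul_left_eq_self (μ := μ)
          (fun v : unitary A => ι v * X * star (ι v)) w
        rw [← this]
        congr 1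
        ext1 v
        simp only [Submonoid.coe_mul, map_mul, star_mul, mul_assoc]
      have h2 : star (ι (w : A)) * ι w = 1 := by
        rw [← map_star, ← map_mul, Unitary.coe_star_mul_self, map_one]
      calc ι w * Φ X = ι w * Φ X * (star (ι w) * ι w) := by rw [h2, mul_one]
        _ = (ι w * Φ X * star (ι w)) * ι w := by noncomm_ring
        _ = Φ X * ι w := by rw [h1]
    intro b
    have hb : b ∈ Submodule.span ℂ (unitary A : Set A) := by
      rw [CStarAlgebra.span_unitary]; trivial
    induction hb using Submodule.span_induction with
    | mem x h => exact inv ⟨x, h⟩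
    | zero => simp
    | add x y _ _ hx hy => rw [map_add, add_mul, mul_add, hx, hy]
    | smul a x _ hx => rw [map_smul, smul_mul_assoc, mul_smul_comm, hx]
  · set e := Module.finBasis ℂ A with he
    have φc : ∀ i, Continuous fun a : A => e.repr a i := fun i =>
      (LinearMap.toContinuousLinearMap (e.coord i)).continuous
    have bc : ∀ i, Continuous fun v : unitary A => e.repr (v : A) i • star (v : A) := fun i =>
      ((φc i).comp continuous_subtype_val).smul continuous_subtype_val.star
    refine ⟨_, e, fun i => ∫ v : unitary A, e.repr (v : A) i • star (v : A) ∂μ, ?_, ?_⟩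
    · intro X
      have h1 : ∀ i, ι (∫ v : unitary A, e.repr (v : A) i • star (v : A) ∂μ)
          = ∫ v : unitary A, e.repr (v : A) i • star (ι v) ∂μ := fun i => by
        have := ιL.integral_comp_comm (intA (bc i))
        rw [← ιL', ← this]
        congr 1; ext1 v
        rw [map_smul, ιL', map_star]
      have ic : ∀ i, Continuous fun v : unitary A => e.repr (v : A) i • star (ι v) := fun i =>
        ((φc i).comp continuous_subtype_val).smul (ιc.comp continuous_subtype_val).star
      simp only [h1]
      rw [Φd]
      have h2 : ∀ i, ι (e i) * X * ∫ v : unitary A, e.repr (v : A) i • star (ι v) ∂μ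
          = ∫ v : unitary A, ι (e i) * X * (e.repr (v : A) i • star (ι v)) ∂μ := fun i => by
        rw [integral_const_mul_of_integrable (int (ic i))]
      simp only [h2]
      rw [← integral_finsetSum _ (fun i _ => int (cml _ (ic i)))]
      congr 1
      ext1 v
      nth_rw 1 [← e.sum_repr (v : A)]
      simp only [map_sum, map_smul, Finset.sum_mul, smul_mul_assoc, mul_smul_comm]
    · have h2 : ∀ i, (∫ v : unitary A, e.repr (v : A) i • star (v : A) ∂μ) * e i
          = ∫ v : unitary A, (e.repr (v : A) i • star (v : A)) * e i ∂μ := fun i => by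
        rw [integral_mul_const_of_integrable (intA (bc i))]
      simp only [h2]
      rw [← integral_finsetSum _ (fun i _ => intA (cmr _ (bc i)))]
      have : ∀ v : unitary A, ∑ i, (e.repr (v : A) i • star (v : A)) * e i = 1 := fun v => by
        have : ∑ i, (e.repr (v : A) i • star (v : A)) * e i
            = star (v : A) * ∑ i, e.repr (v : A) i • e i := by
          simp only [Finset.mul_sum, smul_mul_assoc, mul_smul_comm]
        rw [this, e.sum_repr, Unitary.coe_star_mul_self]
      simp only [this]
      simp
  · intro k a x y c h
    have h2 : ∀ (z : Fin k → Op H), ∑ i, a i * Φ (z i)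
        = ∫ v : unitary A, ∑ i, a i * (ι v * z i * star (ι v)) ∂μ := fun z => by
      rw [integral_finsetSum _ (fun i _ => int (cml _ (fc (z i))))]
      refine Finset.sum_congr rfl fun i _ => ?_
      rw [integral_const_mul_of_integrable (int (fc (z i))), Φd]
    rw [h2, h2, ← integral_const_mul_of_integrable
      (int (continuous_finsetSum _ fun i _ => cml _ (fc (y i))))]
    congr 1
    ext1 v
    exact h v v.2

structure AvgMap (B : StarSubalgebra ℂ (Op H)) (Φ : Op H →ₗ[ℂ] Op H) : Prop where
  bound : ∀ (X Y : Op H) (ζ : H) (c : ℝ), (∀ v ∈ B, v ∈ unitary (Op H) →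
        ‖(v * X * star v) ζ - Y ζ‖ ≤ c) → ‖Φ X ζ - Y ζ‖ ≤ c
  comm : ∀ X, ∀ b ∈ B, b * Φ X = Φ X * b
  expr : ∃ (n : ℕ) (e b : Fin n → Op H), (∀ i, e i ∈ B) ∧ (∀ i, b i ∈ B) ∧
        (∀ X, Φ X = ∑ i, e i * X * b i) ∧ ∑ i, b i * e i = 1
  ident : ∀ (k : ℕ) (a x y : Fin k → Op H) (c : Op H), (∀ u ∈ B, u ∈ unitary (Op H) →
        ∑ i, a i * (u * x i * star u) = c * ∑ i, a i * (u * y i * star u)) →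
        ∑ i, a i * Φ (x i) = c * ∑ i, a i * Φ (y i)

lemma exists_avg (B : StarSubalgebra ℂ (Op H)) (hB : FinDim (B : Set (Op H))) :
    ∃ Φ : Op H →ₗ[ℂ] Op H, AvgMap B Φ := by
  obtain ⟨s, hs⟩ := hB
  have fd : FiniteDimensional ℂ (Subalgebra.toSubmodule B.toSubalgebra) := by
    have : FiniteDimensional ℂ (Submodule.span ℂ (s : Set (Op H))) :=
      FiniteDimensional.span_finset ℂ s
    exact Submodule.finiteDimensional_of_le (S₂ := Submodule.span ℂ (s : Set (Op H))) hs
  have hcl : IsClosed (B : Set (Op H)) :=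
    Submodule.closed_of_finiteDimensional (Subalgebra.toSubmodule B.toSubalgebra)
  have : FiniteDimensional ℂ B := fd
  have hun : ∀ v : B, v ∈ unitary B → (v : Op H) ∈ unitary (Op H) := fun v hv => by
    rw [Unitary.mem_iff] at hv ⊢
    exact ⟨congrArg Subtype.val hv.1, congrArg Subtype.val hv.2⟩
  obtain ⟨Φ, h1, h2, ⟨n, e, b, h3, h4⟩, h5⟩ := exists_avg_aux (A := B) B.subtype
  refine ⟨Φ, fun X Y ζ c h => h1 X Y ζ c fun v hv => h v v.2 (hun v hv),
    fun X b hb => h2 X ⟨b, hb⟩,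
    ⟨n, fun i => e i, fun i => b i, fun i => (e i).2, fun i => (b i).2, h3, ?_⟩,
    fun k a x y c h => h5 k a x y c fun u hu => h u u.2 (hun u hu)⟩
  have := congrArg Subtype.val h4
  simpa using this

end Avg

section LemmaC

variable {ω : Ultrafilter ℕ} {M Mω : VonNeumannAlgebra H} {τ : Op H →ₗ[ℂ] ℂ}
  {limω : (ℕ → Op H) → Op H}

namespace AvgMap

variable {B : StarSubalgebra ℂ (Op H)} {Φ : Op H →ₗ[ℂ] Op H}

lemma norm_le (h : AvgMap B Φ) (X : Op H) : ‖Φ X‖ ≤ ‖X‖ := by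
  refine ContinuousLinearMap.opNorm_le_bound _ (norm_nonneg _) fun ζ => ?_
  have := h.bound X 0 ζ (‖X‖ * ‖ζ‖) (fun v _ hv => by
    rw [zero_apply, sub_zero]
    refine ((v * X * star v).le_opNorm ζ).trans ?_
    gcongr
    rw [CStarRing.norm_mul_mem_unitary _ (Unitary.star_mem hv), CStarRing.norm_mem_unitary_mul _ hv])
  simpa using this

lemma map_left (h : AvgMap B Φ) {t : Op H} (ht : ∀ b ∈ B, b * t = t * b) (X : Op H) :
    Φ (t * X) = t * Φ X := by
  obtain ⟨n, e, b, he, hb, hΦ, -⟩ := h.expr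
  rw [hΦ, hΦ, Finset.mul_sum]
  refine Finset.sum_congr rfl fun i _ => ?_
  rw [← mul_assoc, ht _ (he i)]; noncomm_ring

lemma map_right (h : AvgMap B Φ) {t : Op H} (ht : ∀ b ∈ B, b * t = t * b) (X : Op H) :
    Φ (X * t) = Φ X * t := by
  obtain ⟨n, e, b, he, hb, hΦ, -⟩ := h.expr
  rw [hΦ, hΦ, Finset.sum_mul]
  refine Finset.sum_congr rfl fun i _ => ?_
  rw [mul_assoc (e i * X), ht _ (hb i)]; noncomm_ring

lemma mem (h : AvgMap B Φ) (hB : (B : Set (Op H)) ⊆ M) {X : Op H} (hX : X ∈ M) : Φ X ∈ M := by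
  obtain ⟨n, e, b, he, hb, hΦ, -⟩ := h.expr
  rw [hΦ]
  exact sum_mem fun i _ => mul_mem (mul_mem (hB (he i)) hX) (hB (hb i))

lemma tr (h : AvgMap B Φ) (hτ : IsTracialState (M : Set (Op H)) τ)
    (hB : (B : Set (Op H)) ⊆ M) {X : Op H} (hX : X ∈ M) : τ (Φ X) = τ X := by
  obtain ⟨n, e, b, he, hb, hΦ, h1⟩ := h.expr
  rw [hΦ, map_sum]
  have : ∀ i, τ (e i * X * b i) = τ (X * (b i * e i)) := fun i => by
    rw [mul_assoc, hτ.tracial _ (hB (he i)) _ (mul_mem hX (hB (hb i))), mul_assoc]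
  simp only [this]
  rw [← map_sum, ← Finset.mul_sum, h1, mul_one]

end AvgMap

lemma tr_star (hτ : IsTracialState (M : Set (Op H)) τ) {z : Op H} (hz : z ∈ M) :
    τ (star z) = star (τ z) := by
  have h1 := (Complex.le_def.1 (hτ.pos (1 + z) (add_mem (one_mem M) hz))).2
  have h2 := (Complex.le_def.1 (hτ.pos (1 + Complex.I • z)
    (add_mem (one_mem M) (smul_mem' M _ hz)))).2
  have h3 := (Complex.le_def.1 (hτ.pos z hz)).2
  simp only [star_add, star_one, star_smul, mul_add, add_mul, one_mul, mul_one, map_add,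
    smul_mul_assoc, mul_smul_comm, map_smul, hτ.map_one, smul_eq_mul] at h1 h2
  simp at h1 h2 h3
  apply Complex.ext
  · simp; linarith
  · simp; linarith

lemma comm_of_strong {x : ℕ → Op H} {X y : Op H}
    (h : ∀ ζ, Tendsto (fun n => x n ζ) atTop (nhds (X ζ)))
    (hc : ∀ᶠ n in atTop, y * x n = x n * y) : y * X = X * y := by
  ext ζ
  have h1 : Tendsto (fun n => y (x n ζ)) atTop (nhds (y (X ζ))) :=
    (y.continuous.tendsto _).comp (h ζ)
  have h2 := h (y ζ)
  refine tendsto_nhds_unique h1 (h2.congr' ?_)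
  filter_upwards [hc] with n hn
  exact (congrArg (fun T : Op H => T ζ) hn).symm

lemma lemmaC (hω : IsFreeUltrafilter ω) (hU : IsTracialUltrapower ω M Mω τ limω)
    {B : ℕ → StarSubalgebra ℂ (Op H)} (hmono : Monotone B) (hBM : ∀ n, (B n : Set (Op H)) ⊆ M)
    {Φ : ℕ → Op H →ₗ[ℂ] Op H} (hΦ : ∀ n, AvgMap (B n) (Φ n))
    (hsc : ∀ y ∈ M, (∀ n, ∀ b ∈ B n, b * y = y * b) → ∃ c : ℂ, y = c • (1 : Op H))
    {b : Op H} (hb : b ∈ M) (ζ : H) :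
    Tendsto (fun n => Φ n b ζ) atTop (nhds (τ b • ζ)) := by
  have hτ := trM hU
  set β : ℕ → Op H := fun n => Φ n b with hβ
  have βM : ∀ n, β n ∈ M := fun n => (hΦ n).mem (hBM n) hb
  have βn : ∀ n, ‖β n‖ ≤ ‖b‖ := fun n => (hΦ n).norm_le b
  have βc : ∀ j k, j ≤ k → ∀ a ∈ B j, a * β k = β k * a :=
    fun j k hjk a ha => (hΦ k).comm b a (hmono hjk ha)
  have βc' : ∀ j k, j ≤ k → ∀ a ∈ B j, a * star (β k) = star (β k) * a := fun j k hjk a ha => by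
    have := congrArg star (βc j k hjk (star a) (star_mem ha))
    simpa using this.symm
  have t1 : ∀ j k, j ≤ k → τ (star (β k) * β j) = τ (star (β k) * b) := fun j k hjk => by
    rw [hβ]
    simp only
    rw [← (hΦ j).map_left (βc' j k hjk) b, (hΦ j).tr hτ (hBM j) (mul_mem (star_mem (βM k)) hb)]
  have t2 : ∀ j k, j ≤ k → τ (star (β k) * β j) = (n2 τ (β k) : ℂ) := fun j k hjk => by
    rw [t1 j k hjk, ← t1 k k le_rfl, tr_eq_n2 hτ (βM k)]
  have r : ∀ j k, j ≤ k → n2 τ (β k - β j) = n2 τ (β j) - n2 τ (β k) := fun j k hjk => by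
    have a1 := t2 j k hjk
    have a2 : τ (star (β j) * β k) = (n2 τ (β k) : ℂ) := by
      have := tr_star hτ (mul_mem (star_mem (βM k)) (βM j))
      rw [a1] at this
      simpa using this
    have : n2 τ (β k - β j) = (τ (star (β k) * β k) - τ (star (β k) * β j)
        - τ (star (β j) * β k) + τ (star (β j) * β j)).re := by
      unfold n2
      rw [← map_sub, ← map_sub, ← map_add]
      congr 2
      rw [star_sub]; noncomm_ring
    rw [this, a1, a2]
    simp [n2]
    ring
  have anti : Antitone fun n => n2 τ (β n) := fun j k hjk => by
    have := n2_nonneg hτ (sub_mem (βM k) (βM j))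
    rw [r j k hjk] at this
    simpa using this
  have bdd : BddBelow (Set.range fun n => n2 τ (β n)) :=
    ⟨0, by rintro _ ⟨n, rfl⟩; exact n2_nonneg hτ (βM n)⟩
  have conv := tendsto_atTop_ciInf anti bdd
  set L := ⨅ n, n2 τ (β n) with hL
  have Lle : ∀ n, L ≤ n2 τ (β n) := fun n => ciInf_le bdd n
  obtain ⟨φ, φm, hφ⟩ := extraction_forall_of_eventually
    (P := fun n k => n2 τ (β k) ≤ L + (1 / 8) ^ n) (fun n => by
      have := conv.eventually (eventually_le_nhds (show L < L + (1 / 8) ^ n by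
        have : (0 : ℝ) < (1 / 8) ^ n := by positivity
        linarith))
      exact this)
  have close : ∀ n j, φ n ≤ j → n2 τ (β j - β (φ n)) ≤ (1 / 8) ^ n := fun n j hj => by
    rw [r _ _ hj]
    linarith [hφ n, Lle j]
  have xM : SeqIn (M : Set (Op H)) (fun n => β (φ n)) := fun n => βM _
  have xb : Bdd (fun n => β (φ n)) := ⟨_, fun n => βn _⟩
  have sot := lemmaA hω hU xM (fun n => βn (φ n))
    (fun n => close n _ (φm.monotone (Nat.le_succ n)))
  set X := limω fun n => β (φ n) with hX
  have XM : X ∈ M := mem_of_comm M fun y hy => comm_of_strong sot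
    (Eventually.of_forall fun n => (comm_of_mem M (βM _) hy).symm)
  obtain ⟨c, hc⟩ := hsc X XM fun j a ha => comm_of_strong sot (by
    filter_upwards [eventually_ge_atTop j] with n hn
    exact βc j _ (hn.trans (φm.id_le n)) a ha)
  have hcτ : c = τ b := by
    have h1 := hU.tr _ xM xb
    rw [← hX, hc, map_smul, hτ.map_one, smul_eq_mul, mul_one] at h1
    have h2 : (fun n => τ (β (φ n))) = fun _ => τ b := by
      ext n; exact (hΦ _).tr hτ (hBM _) hb
    rw [h2] at h1
    exact (tendsto_nhds_unique tendsto_const_nhds h1).symm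
  have c1M : c • (1 : Op H) ∈ M := smul_mem' M c (one_mem M)
  have hz : Tendsto (fun n => n2 τ (β (φ n) - c • (1 : Op H))) (ω : Filter ℕ) (nhds 0) := by
    have h1 : limω (fun n => β (φ n) - c • (1 : Op H)) = 0 := by
      rw [lim_sub hU xM xb (fun _ => c1M) (Bdd.const _), hU.diag _ c1M, ← hX, hc, sub_self]
    have h2 := (hU.eq_zero _ (fun n => sub_mem (xM n) c1M) (xb.sub (Bdd.const _))).1 h1
    refine h2.congr fun n => ?_
    exact norm_tr hτ (sub_mem (xM n) c1M)
  have h8 : Tendsto (fun n : ℕ => (1 / 8 : ℝ) ^ n) atTop (nhds 0) :=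
    tendsto_pow_atTop_nhds_zero_of_lt_one (by norm_num) (by norm_num)
  rw [← hcτ, Metric.tendsto_atTop]
  intro δ hδ
  obtain ⟨ε, hε, hs⟩ := s1 hω hU ζ (‖b‖ + ‖c • (1 : Op H)‖) (half_pos hδ)
  have ev1 := hz.eventually (eventually_lt_nhds (show (0 : ℝ) < ε / 4 by positivity))
  have ev2 := (h8.mono_left (free_le hω)).eventually
    (eventually_lt_nhds (show (0 : ℝ) < ε / 4 by positivity))
  obtain ⟨n, hn1, hn2⟩ := (ev1.and ev2).exists
  refine ⟨φ n, fun j hj => ?_⟩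
  have e : β j - c • (1 : Op H) = (β j - β (φ n)) - (c • (1 : Op H) - β (φ n)) := by abel
  have e2 : n2 τ (c • (1 : Op H) - β (φ n)) = n2 τ (β (φ n) - c • (1 : Op H)) := by
    rw [← neg_sub]; unfold n2; rw [star_neg, neg_mul_neg]
  have b1 := n2_sub_le hτ (sub_mem (βM j) (βM (φ n))) (sub_mem c1M (βM (φ n)))
  rw [← e, e2] at b1
  have := hs (β j - c • (1 : Op H)) (sub_mem (βM j) c1M)
    ((norm_sub_le _ _).trans (add_le_add (βn j) le_rfl)) (by linarith [close n j hj])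
  rw [dist_eq_norm]
  have e3 : (β j - c • (1 : Op H)) ζ = Φ j b ζ - c • ζ := by simp [hβ]
  rw [e3] at this
  linarith

end LemmaC

section Weak

/-- weak operator limit along `ω` -/
def WL (ω : Ultrafilter ℕ) (X : ℕ → Op H) (Y : Op H) : Prop :=
  ∀ ζ' ζ : H, Tendsto (fun n => inner ℂ ζ' (X n ζ)) (ω : Filter ℕ) (nhds (inner ℂ ζ' (Y ζ)))

variable {ω : Ultrafilter ℕ}

lemma exists_ulim (z : ℕ → ℂ) (C : ℝ) (hz : ∀ n, ‖z n‖ ≤ C) :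
    ∃ c : ℂ, Tendsto z (ω : Filter ℕ) (nhds c) := by
  have hc := isCompact_iff_ultrafilter_le_nhds.1 (isCompact_closedBall (0 : ℂ) C) (ω.map z) (by
    rw [le_principal_iff]
    exact mem_map.2 (univ_mem' fun n => by simpa using hz n))
  obtain ⟨c, -, hc⟩ := hc
  exact ⟨c, hc⟩

lemma exists_wl (X : ℕ → Op H) (C : ℝ) (hC : ∀ n, ‖X n‖ ≤ C) : ∃ Y, WL ω X Y := by
  have hb : ∀ (v w : H) n, ‖inner ℂ (X n v) w‖ ≤ C * ‖v‖ * ‖w‖ := fun v w n =>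
    (norm_inner_le_norm _ _).trans (by gcongr; exact (X n).le_of_opNorm_le (hC n) v)
  choose L hL using fun v w : H => exists_ulim (ω := ω) _ _ (hb v w)
  let B : H →L⋆[ℂ] H →L[ℂ] ℂ := LinearMap.mkContinuous₂
    (LinearMap.mk₂'ₛₗ (starRingEnd ℂ) (RingHom.id ℂ) L
      (fun v v' w => tendsto_nhds_unique (hL (v + v') w) (by
        simpa [inner_add_left] using (hL v w).add (hL v' w)))
      (fun c v w => tendsto_nhds_unique (hL (c • v) w) (by
        simp only [map_smul, inner_smul_left]
        exact (hL v w).const_mul (starRingEnd ℂ c)))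
      (fun v w w' => tendsto_nhds_unique (hL v (w + w')) (by
        simpa [inner_add_right] using (hL v w).add (hL v w')))
      (fun c v w => tendsto_nhds_unique (hL v (c • w)) (by
        simpa [inner_smul_right] using (hL v w).const_mul c))) C
    (fun v w => le_of_tendsto (hL v w).norm (Eventually.of_forall (hb v w)))
  refine ⟨InnerProductSpace.continuousLinearMapOfBilin B, fun ζ' ζ => ?_⟩
  have h1 : inner ℂ (InnerProductSpace.continuousLinearMapOfBilin B ζ) ζ' = L ζ ζ' :=
    InnerProductSpace.continuousLinearMapOfBilin_apply B ζ ζ'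
  have h2 := (Complex.continuous_conj.tendsto _).comp (hL ζ ζ')
  rw [← h1] at h2
  simp only [Function.comp_def, inner_conj_symm] at h2
  exact h2

lemma WL.unique {X : ℕ → Op H} {Y Y' : Op H} (h : WL ω X Y) (h' : WL ω X Y') : Y = Y' := by
  ext ζ
  exact ext_inner_left ℂ fun v => tendsto_nhds_unique (h v ζ) (h' v ζ)

lemma WL.congr {X X' : ℕ → Op H} {Y : Op H} (h : WL ω X Y)
    (hx : ∀ᶠ n in (ω : Filter ℕ), X n = X' n) : WL ω X' Y := fun v w =>
  (h v w).congr' (by filter_upwards [hx] with n hn; rw [hn])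

lemma WL.mul_left {X : ℕ → Op H} {Y : Op H} (h : WL ω X Y) (a : Op H) :
    WL ω (fun n => a * X n) (a * Y) := fun v w => by
  have := h (ContinuousLinearMap.adjoint a v) w
  simp only [ContinuousLinearMap.adjoint_inner_left] at this
  exact this

lemma WL.mul_right {X : ℕ → Op H} {Y : Op H} (h : WL ω X Y) (a : Op H) :
    WL ω (fun n => X n * a) (Y * a) := fun v w => h v (a w)

lemma WL.sum {k : ℕ} {X : Fin k → ℕ → Op H} {Y : Fin k → Op H} (h : ∀ i, WL ω (X i) (Y i)) :
    WL ω (fun n => ∑ i, X i n) (∑ i, Y i) := fun v w => by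
  have := tendsto_finsetSum Finset.univ fun i (_ : i ∈ Finset.univ) => h i v w
  simpa [inner_sum] using this

lemma WL.comm {X : ℕ → Op H} {Y y : Op H} (h : WL ω X Y)
    (hc : ∀ᶠ n in (ω : Filter ℕ), y * X n = X n * y) : y * Y = Y * y :=
  ((h.mul_left y).congr hc).unique (h.mul_right y)

lemma WL.of_strong (hω : IsFreeUltrafilter ω) {X : ℕ → Op H} {Y : Op H}
    (h : ∀ ζ, Tendsto (fun n => X n ζ) atTop (nhds (Y ζ))) : WL ω X Y := fun v w =>
  ((tendsto_const_nhds (x := v)).inner (h w)).mono_left (free_le hω)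

lemma WL.norm_le {X : ℕ → Op H} {Y : Op H} (h : WL ω X Y) {ζ w : H} {c : ℝ}
    (hc : ∀ᶠ n in (ω : Filter ℕ), ‖X n ζ - w‖ ≤ c) : ‖Y ζ - w‖ ≤ c := by
  set v := Y ζ - w with hv
  have h1 : Tendsto (fun n => inner ℂ v (X n ζ - w)) (ω : Filter ℕ) (nhds (inner ℂ v v)) := by
    have e : inner ℂ v v = inner ℂ v (Y ζ) - inner ℂ v w := by rw [← inner_sub_right]
    rw [e]
    simp only [inner_sub_right]
    exact (h v ζ).sub_const _
  have h2 := le_of_tendsto h1.norm (b := ‖v‖ * c) (by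
    filter_upwards [hc] with n hn
    exact (norm_inner_le_norm _ _).trans (by gcongr))
  rw [inner_self_eq_norm_sq_to_K] at h2
  simp at h2
  by_contra! hlt
  obtain ⟨n, hn⟩ := hc.exists
  have : 0 ≤ c := (norm_nonneg _).trans hn
  nlinarith

end Weak

section Casimir

variable {M : VonNeumannAlgebra H} {τ : Op H →ₗ[ℂ] ℂ}

lemma casimir (hτ : IsTracialState (M : Set (Op H)) τ) (A : StarSubalgebra ℂ (Op H))
    (hA : FinDim (A : Set (Op H))) (hAM : (A : Set (Op H)) ⊆ M) :
    ∃ (k : ℕ) (e f : Fin k → Op H), (∀ i, e i ∈ A) ∧ (∀ i, f i ∈ A) ∧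
      (∀ X, ∀ a ∈ A, a * ∑ i, e i * X * f i = (∑ i, e i * X * f i) * a) ∧
      ∑ i, τ (f i) • e i = 1 := by
  obtain ⟨s, hs⟩ := hA
  have fd : FiniteDimensional ℂ (Subalgebra.toSubmodule A.toSubalgebra) := by
    have : FiniteDimensional ℂ (Submodule.span ℂ (s : Set (Op H))) :=
      FiniteDimensional.span_finset ℂ s
    exact Submodule.finiteDimensional_of_le (S₂ := Submodule.span ℂ (s : Set (Op H))) hs
  have : FiniteDimensional ℂ A := fd
  let β : LinearMap.BilinForm ℂ A := LinearMap.mk₂ ℂ (fun a b : A => τ ((a : Op H) * b))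
    (fun a a' b => by simp [add_mul]) (fun c a b => by simp)
    (fun a b b' => by simp [mul_add]) (fun c a b => by simp)
  have βa : ∀ a b : A, β a b = τ ((a : Op H) * b) := fun _ _ => rfl
  have βs : ∀ a b : A, β a b = β b a := fun a b => by
    rw [βa, βa, hτ.tracial _ (hAM a.2) _ (hAM b.2)]
  have hnd : β.Nondegenerate := by
    have hr : ∀ a : A, (∀ b : A, β b a = 0) → a = 0 := fun a ha => by
      have h := ha (star a)
      rw [βa] at h
      exact Subtype.ext (hτ.faithful a (hAM a.2) h)
    exact ⟨fun a ha => hr a fun b => by rw [βs]; exact ha b, hr⟩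
  set e := Module.finBasis ℂ A with he
  set f := LinearMap.BilinForm.dualBasis β hnd e with hf
  have xf : ∀ x : A, x = ∑ i, τ ((x : Op H) * e i) • f i := fun x => by
    conv_lhs => rw [← f.sum_repr x]
    refine Finset.sum_congr rfl fun i _ => ?_
    rw [hf, LinearMap.BilinForm.dualBasis_repr_apply, βa]
  have xe : ∀ x : A, x = ∑ i, τ ((f i : Op H) * x) • e i := fun x => by
    conv_lhs => rw [← e.sum_repr x]
    refine Finset.sum_congr rfl fun i _ => ?_
    congr 1
    rw [← βa]
    conv_rhs => rw [← e.sum_repr x]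
    rw [map_sum]
    simp only [map_smul, hf, LinearMap.BilinForm.apply_dualBasis_left]
    simp
  have xf' : ∀ x ∈ A, x = ∑ i, τ (x * e i) • (f i : Op H) := fun x hx => by
    have := congrArg Subtype.val (xf ⟨x, hx⟩)
    simpa using this
  have xe' : ∀ x ∈ A, x = ∑ i, τ ((f i : Op H) * x) • (e i : Op H) := fun x hx => by
    have := congrArg Subtype.val (xe ⟨x, hx⟩)
    simpa using this
  refine ⟨_, fun i => e i, fun i => f i, fun i => (e i).2, fun i => (f i).2, ?_, ?_⟩
  · intro X a ha
    have l : a * ∑ i, (e i : Op H) * X * f i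
        = ∑ i, ∑ j, τ ((f j : Op H) * (a * e i)) • ((e j : Op H) * X * f i) := by
      rw [Finset.mul_sum]
      refine Finset.sum_congr rfl fun i _ => ?_
      rw [← mul_assoc, ← mul_assoc]
      nth_rw 1 [xe' (a * e i) (mul_mem ha (e i).2)]
      simp only [Finset.sum_mul, smul_mul_assoc]
    have r : (∑ i, (e i : Op H) * X * f i) * a
        = ∑ j, ∑ i, τ ((f j : Op H) * (a * e i)) • ((e j : Op H) * X * f i) := by
      rw [Finset.sum_mul]
      refine Finset.sum_congr rfl fun j _ => ?_
      rw [mul_assoc]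
      nth_rw 1 [xf' (f j * a) (mul_mem (f j).2 ha)]
      simp only [Finset.mul_sum, mul_smul_comm, mul_assoc]
    rw [l, r, Finset.sum_comm]
  · have := xe' 1 (one_mem A)
    simpa using this.symm

end Casimir

section Final

variable {ω : Ultrafilter ℕ} {M N Mω : VonNeumannAlgebra H} {τ : Op H →ₗ[ℂ] ℂ}
  {limω : (ℕ → Op H) → Op H}

lemma unitary_norm {u : Op H} (hu : u ∈ unitary (Op H)) (ζ : H) : ‖u ζ‖ = ‖ζ‖ := by
  have h : inner ℂ (u ζ) (u ζ) = inner ℂ ζ ζ := by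
    rw [← ContinuousLinearMap.adjoint_inner_right]
    have := congrArg (fun z : Op H => z ζ) (Unitary.star_mul_self_of_mem hu)
    exact congrArg (inner ℂ ζ) this
  rw [inner_self_eq_norm_sq_to_K, inner_self_eq_norm_sq_to_K] at h
  have h2 : ‖u ζ‖ ^ 2 = ‖ζ‖ ^ 2 := by exact_mod_cast h
  exact (sq_eq_sq₀ (norm_nonneg _) (norm_nonneg _)).1 h2

lemma unitary_opNorm {u : Op H} (hu : u ∈ unitary (Op H)) : ‖u‖ ≤ 1 :=
  u.opNorm_le_bound zero_le_one fun ζ => by rw [unitary_norm hu, one_mul]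

lemma delta_claim (hω : IsFreeUltrafilter ω) (hU : IsTracialUltrapower ω M Mω τ limω)
    (hNM : (N : Set (Op H)) ⊆ (M : Set (Op H)))
    (hcs : relComm (M : Set (Op H)) (Mω : Set (Op H)) ⊆ ultrapowerSet limω (N : Set (Op H)))
    {A : ℕ → StarSubalgebra ℂ (Op H)} (hA : Monotone A)
    (hAM : ∀ n, (A n : Set (Op H)) ⊆ M)
    (hAcc : Set.centralizer (Set.centralizer (⋃ n, (A n : Set (Op H)))) = (M : Set (Op H)))
    {T : Op H} (hT : T ∈ Set.centralizer (N : Set (Op H))) (ζ : H) {δ : ℝ} (hδ : 0 < δ) :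
    ∃ n, ∀ u ∈ M, u ∈ unitary (Op H) → (∀ a ∈ A n, a * u = u * a) →
      ∀ w ∈ N, w ∈ unitary (Op H) → ‖(T * u - u * T) (w ζ)‖ ≤ δ := by
  by_contra! hcon
  choose u uM uu uc w wN wu hbig using hcon
  have hτ := trM hU
  have bu : Bdd u := ⟨1, fun n => unitary_opNorm (uu n)⟩
  have Ucomm : ∀ k, ∀ a ∈ A k, a * limω u = limω u * a := fun k a ha => by
    have aM : a ∈ M := hAM k ha
    have h1 := hU.map_mul (fun _ => a) u (fun _ => aM) (Bdd.const a) uM bu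
    have h2 := hU.map_mul u (fun _ => a) uM bu (fun _ => aM) (Bdd.const a)
    rw [hU.diag a aM] at h1 h2
    rw [← h1, ← h2]
    refine lim_eq_of hU (fun n => mul_mem aM (uM n)) ((Bdd.const a).mul bu)
      (fun n => mul_mem (uM n) aM) (bu.mul (Bdd.const a)) ?_
    filter_upwards [free_le hω (eventually_ge_atTop k)] with n hn
    exact uc n a (hA hn ha)
  have UM : limω u ∈ relComm (M : Set (Op H)) (Mω : Set (Op H)) := by
    refine ⟨hU.mem u uM bu, fun m hm => ?_⟩
    have hUc : limω u ∈ Set.centralizer (⋃ n, (A n : Set (Op H))) := by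
      intro a ha
      obtain ⟨k, hk⟩ := Set.mem_iUnion.1 ha
      exact Ucomm k a hk
    rw [← hAcc] at hm
    exact (hm _ hUc).symm
  obtain ⟨y, yN, yb, hy⟩ := hcs UM
  have yM : SeqIn (M : Set (Op H)) y := fun n => hNM (yN n)
  have bd : Bdd (fun n => u n - y n) := bu.sub yb
  have dM : ∀ n, u n - y n ∈ M := fun n => sub_mem (uM n) (yM n)
  have hz : Tendsto (fun n => n2 τ (u n - y n)) (ω : Filter ℕ) (nhds 0) := by
    have h1 : limω (fun n => u n - y n) = 0 := by
      rw [lim_sub hU uM bu yM yb, hy, sub_self]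
    refine ((hU.eq_zero _ dM bd).1 h1).congr fun n => norm_tr hτ (dM n)
  obtain ⟨C, hC⟩ := bd
  have hδ1 : 0 < δ / (2 * (‖T‖ + 1)) := by positivity
  obtain ⟨ε1, hε1, h1⟩ := s1 hω hU ζ C hδ1
  obtain ⟨ε2, hε2, h2⟩ := s1 hω hU (T ζ) C (show 0 < δ / 4 by positivity)
  obtain ⟨n, hn1, hn2⟩ := ((hz.eventually (eventually_lt_nhds hε1)).and
    (hz.eventually (eventually_lt_nhds hε2))).exists
  have wM : w n ∈ M := hNM (wN n)
  set d := u n - y n with hd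
  have dwM : d * w n ∈ M := mul_mem (dM n) wM
  have dwn : n2 τ (d * w n) = n2 τ d := by
    unfold n2
    rw [star_mul, hτ.tracial _ (mul_mem (star_mem wM) (star_mem (dM n))) _ dwM]
    rw [show d * w n * (star (w n) * star d) = d * (w n * star (w n)) * star d by noncomm_ring,
      Unitary.mul_star_self_of_mem (wu n), mul_one, hτ.tracial _ (dM n) _ (star_mem (dM n))]
  have dwC : ‖d * w n‖ ≤ C :=
    (norm_mul_le _ _).trans ((mul_le_mul (hC n) (unitary_opNorm (wu n)) (norm_nonneg _)
      ((norm_nonneg _).trans (hC n))).trans (mul_one C).le)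
  have k1 := h1 _ dwM dwC (by rw [dwn]; exact hn1.le)
  have k2 := h2 _ dwM dwC (by rw [dwn]; exact hn2.le)
  have ty : y n * T = T * y n := hT _ (yN n)
  have tw : w n * T = T * w n := hT _ (wN n)
  have e : (T * u n - u n * T) * w n = T * (d * w n) - (d * w n) * T := by
    have : u n = d + y n := by rw [hd]; abel
    rw [mul_assoc d, tw, this, mul_add, add_mul, ty]
    noncomm_ring
  have e' : (T * u n - u n * T) (w n ζ) = T ((d * w n) ζ) - (d * w n) (T ζ) :=
    congrArg (fun z : Op H => z ζ) e
  have hb := hbig n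
  rw [e'] at hb
  have k3 : ‖T ((d * w n) ζ)‖ ≤ δ / 2 := by
    refine (T.le_opNorm _).trans ?_
    calc ‖T‖ * ‖(d * w n) ζ‖ ≤ (‖T‖ + 1) * (δ / (2 * (‖T‖ + 1))) := by
          gcongr; linarith
      _ = δ / 2 := by field_simp
  linarith [norm_sub_le (T ((d * w n) ζ)) ((d * w n) (T ζ))]

lemma lemmaE (hω : IsFreeUltrafilter ω) (hU : IsTracialUltrapower ω M Mω τ limω)
    (hMf : relComm (M : Set (Op H)) (M : Set (Op H)) = scalars H)
    {A : ℕ → StarSubalgebra ℂ (Op H)} (hA : Monotone A)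
    (hAM : ∀ n, (A n : Set (Op H)) ⊆ M) (hAf : ∀ n, FinDim (A n : Set (Op H)))
    (hAcc : Set.centralizer (Set.centralizer (⋃ n, (A n : Set (Op H)))) = (M : Set (Op H)))
    (n : ℕ) (T : Op H) :
    ∃ (η : Op H) (k : ℕ) (e t : Fin k → Op H), (∀ i, e i ∈ M) ∧
      (∀ i, t i ∈ Set.centralizer (M : Set (Op H))) ∧ η = ∑ i, e i * t i ∧
      ∀ (ζ : H) (c : ℝ), (∀ v ∈ M, v ∈ unitary (Op H) → (∀ a ∈ A n, a * v = v * a) →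
        ‖(v * T * star v) ζ - T ζ‖ ≤ c) → ‖η ζ - T ζ‖ ≤ c := by
  have hτ := trM hU
  have hM' : ∀ x : Op H, (∀ l, ∀ a ∈ A l, a * x = x * a) →
      x ∈ Set.centralizer (M : Set (Op H)) := fun x hx m hm => by
    have hUc : x ∈ Set.centralizer (⋃ n, (A n : Set (Op H))) := by
      intro a ha
      obtain ⟨k, hk⟩ := Set.mem_iUnion.1 ha
      exact hx k a hk
    rw [← hAcc] at hm
    exact (hm _ hUc).symm
  have hsc : ∀ y ∈ M, (∀ n, ∀ b ∈ A n, b * y = y * b) → ∃ c : ℂ, y = c • (1 : Op H) :=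
    fun y hy h => by
      have : y ∈ relComm (M : Set (Op H)) (M : Set (Op H)) := ⟨hy, fun m hm => hM' y h m hm⟩
      rw [hMf] at this
      exact this
  let D : ℕ → StarSubalgebra ℂ (Op H) := fun m =>
    StarSubalgebra.centralizer ℂ (A n : Set (Op H)) ⊓ A m
  have memD : ∀ {m x}, x ∈ D m ↔ (∀ a ∈ A n, a * x = x * a) ∧ x ∈ A m := fun {m x} => by
    simp only [D, StarSubalgebra.mem_inf, StarSubalgebra.mem_centralizer_iff]
    refine and_congr_left fun _ => ⟨fun h a ha => (h a ha).1, fun h a ha =>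
      ⟨h a ha, h _ (star_mem ha)⟩⟩
  have Dm : Monotone D := fun i j hij => inf_le_inf_left _ (hA hij)
  choose Ψ hΨ using fun m => exists_avg (D m) (by
    obtain ⟨s, hs⟩ := hAf m
    exact ⟨s, fun x hx => hs (memD.1 hx).2⟩)
  obtain ⟨η, hη⟩ := exists_wl (ω := ω) (fun m => Ψ m T) _ (fun m => (hΨ m).norm_le T)
  have ηc : ∀ m, ∀ x ∈ D m, x * η = η * x := fun m x hx => hη.comm (by
    filter_upwards [free_le hω (eventually_ge_atTop m)] with j hj
    exact (hΨ j).comm T x (Dm hj hx))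
  obtain ⟨k, e, f, eA, fA, hcas, hone⟩ := casimir hτ (A n) (hAf n) (hAM n)
  choose Φ hΦ using fun m => exists_avg (A m) (hAf m)
  choose t ht using fun i => exists_wl (ω := ω) (fun l => Φ l (f i * η)) _
    (fun l => (hΦ l).norm_le (f i * η))
  have tM : ∀ i, t i ∈ Set.centralizer (M : Set (Op H)) := fun i => hM' _ fun l a ha =>
    (ht i).comm (by
      filter_upwards [free_le hω (eventually_ge_atTop l)] with j hj
      exact (hΦ j).comm _ a (hA hj ha))
  refine ⟨η, k, e, t, fun i => hAM n (eA i), tM, ?_, ?_⟩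
  · have key : ∀ l, n ≤ l → ∑ i, e i * Φ l (f i * η) = η * ∑ i, e i * Φ l (f i) := fun l hl => by
      refine (hΦ l).ident k e (fun i => f i * η) f η fun u hu _ => ?_
      have hc : ∑ i, e i * u * f i ∈ D l := memD.2 ⟨hcas u, sum_mem fun i _ =>
        mul_mem (mul_mem (hA hl (eA i)) hu) (hA hl (fA i))⟩
      have := congrArg (· * star u) (ηc l _ hc)
      simpa only [Finset.sum_mul, Finset.mul_sum, mul_assoc] using this
    have w1 : WL ω (fun l => ∑ i, e i * Φ l (f i * η)) (∑ i, e i * t i) :=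
      WL.sum fun i => (ht i).mul_left (e i)
    have w2 : WL ω (fun l => η * ∑ i, e i * Φ l (f i)) (η * ∑ i, e i * (τ (f i) • (1 : Op H))) := by
      refine WL.mul_left (WL.sum fun i => WL.mul_left (WL.of_strong hω fun ζ => ?_) (e i)) η
      simpa using lemmaC hω hU hA hAM hΦ hsc (hAM n (fA i)) ζ
    have e1 : ∑ i, e i * (τ (f i) • (1 : Op H)) = 1 := by
      simpa using hone
    rw [e1, mul_one] at w2
    refine w2.unique (w1.congr ?_)
    filter_upwards [free_le hω (eventually_ge_atTop n)] with l hl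
    exact key l hl
  · intro ζ c hc
    refine hη.norm_le (Eventually.of_forall fun m => (hΨ m).bound T T ζ c fun v hv vu => ?_)
    exact hc v (hAM m (memD.1 hv).2) vu (memD.1 hv).1

lemma centralizer_sub (hω : IsFreeUltrafilter ω) (hU : IsTracialUltrapower ω M Mω τ limω)
    (hMf : relComm (M : Set (Op H)) (M : Set (Op H)) = scalars H)
    (hMhf : IsHyperfinite M) (hNhf : IsHyperfinite N)
    (hNM : (N : Set (Op H)) ⊆ (M : Set (Op H)))
    (hirr : relComm (N : Set (Op H)) (M : Set (Op H)) = scalars H)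
    (hcs : relComm (M : Set (Op H)) (Mω : Set (Op H)) ⊆ ultrapowerSet limω (N : Set (Op H)))
    {T : Op H} (hT : T ∈ Set.centralizer (N : Set (Op H))) :
    T ∈ Set.centralizer (M : Set (Op H)) := by
  obtain ⟨A, hA, hAM, hAf, hAcc⟩ := hMhf
  obtain ⟨B, hB, hBN, hBf, hBcc⟩ := hNhf
  have hBM : ∀ n, (B n : Set (Op H)) ⊆ M := fun n => (hBN n).trans hNM
  choose Φ hΦ using fun m => exists_avg (B m) (hBf m)
  have hsc : ∀ y ∈ M, (∀ n, ∀ b ∈ B n, b * y = y * b) → ∃ c : ℂ, y = c • (1 : Op H) :=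
    fun y hy h => by
      have : y ∈ relComm (N : Set (Op H)) (M : Set (Op H)) := ⟨hy, fun m hm => by
        have hUc : y ∈ Set.centralizer (⋃ n, (B n : Set (Op H))) := by
          intro a ha
          obtain ⟨k, hk⟩ := Set.mem_iUnion.1 ha
          exact h k a hk
        rw [← hBcc] at hm
        exact (hm _ hUc).symm⟩
      rw [hirr] at this
      exact this
  intro m hm
  ext ζ
  -- a common approximant
  have approx : ∀ δ : ℝ, 0 < δ → ∃ θ ∈ Set.centralizer (M : Set (Op H)),
      ‖θ ζ - T ζ‖ ≤ δ ∧ ‖θ (m ζ) - T (m ζ)‖ ≤ δ := fun δ hδ => by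
    obtain ⟨n1, h1⟩ := delta_claim hω hU hNM hcs hA hAM hAcc hT ζ hδ
    obtain ⟨n2, h2⟩ := delta_claim hω hU hNM hcs hA hAM hAcc hT (m ζ) hδ
    obtain ⟨η, k, e, t, eM, tM, hηe, hηb⟩ := lemmaE hω hU hMf hA hAM hAf hAcc (max n1 n2) T
    refine ⟨∑ i, τ (e i) • t i, ?_, ?_⟩
    · intro x hx
      simp only [Finset.mul_sum, Finset.sum_mul, mul_smul_comm, smul_mul_assoc]
      exact Finset.sum_congr rfl fun i _ => by rw [tM i x hx]
    have main : ∀ (ξ : H) (n' : ℕ), n' ≤ max n1 n2 →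
        (∀ u ∈ M, u ∈ unitary (Op H) → (∀ a ∈ A n', a * u = u * a) →
          ∀ w ∈ N, w ∈ unitary (Op H) → ‖(T * u - u * T) (w ξ)‖ ≤ δ) →
        ‖(∑ i, τ (e i) • t i) ξ - T ξ‖ ≤ δ := fun ξ n' hn' h => by
      have step : ∀ w ∈ N, w ∈ unitary (Op H) → ‖η (w ξ) - T (w ξ)‖ ≤ δ := fun w hw wu => by
        refine hηb (w ξ) δ fun v vM vu vc => ?_
        have e1 : (v * T * star v) (w ξ) - T (w ξ)
            = v ((T * star v - star v * T) (w ξ)) := by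
          have : v * T * star v - T = v * (T * star v - star v * T) := by
            rw [mul_sub, ← mul_assoc v (star v), Unitary.mul_star_self_of_mem vu, one_mul,
              mul_assoc]
          exact congrArg (fun z : Op H => z (w ξ)) this
        rw [e1, unitary_norm vu]
        refine h (star v) (star_mem vM) (Unitary.star_mem vu) (fun a ha => ?_) w hw wu
        have := congrArg star (vc (star a) (hA hn' (star_mem ha)))
        simpa using this.symm
      have lim : Tendsto (fun j => Φ j η ξ) atTop (nhds ((∑ i, τ (e i) • t i) ξ)) := by
        have ej : ∀ j, Φ j η ξ = ∑ i, Φ j (e i) (t i ξ) := fun j => by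
          rw [hηe, map_sum]
          simp only [fun i => (hΦ j).map_right (t := t i)
            (fun b hb => tM i b (hBM j hb)) (e i)]
          simp
        simp only [ej]
        have := tendsto_finsetSum Finset.univ fun i (_ : i ∈ Finset.univ) =>
          lemmaC hω hU hB hBM hΦ hsc (eM i) (t i ξ)
        simpa using this
      refine le_of_tendsto (lim.sub_const _).norm (Eventually.of_forall fun j => ?_)
      refine (hΦ j).bound η T ξ δ fun v hv vu => ?_
      have vN : v ∈ N := hBN j hv
      have tv : v * T = T * v := hT _ vN
      have e1 : (v * η * star v) ξ - T ξ = v (η (star v ξ) - T (star v ξ)) := by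
        have : v * η * star v - T = v * (η * star v - T * star v) := by
          rw [mul_sub, ← mul_assoc v T, tv, mul_assoc T, Unitary.mul_star_self_of_mem vu, mul_one,
            mul_assoc]
        exact congrArg (fun z : Op H => z ξ) this
      rw [e1, unitary_norm vu]
      exact step _ (star_mem vN) (Unitary.star_mem vu)
    exact ⟨main ζ n1 (le_max_left _ _) h1, main (m ζ) n2 (le_max_right _ _) h2⟩
  change m (T ζ) = T (m ζ)
  rw [← sub_eq_zero, ← norm_le_zero_iff]
  refine le_of_forall_pos_le_add fun ε hε => ?_
  obtain ⟨θ, hθ, a1, a2⟩ := approx (ε / (‖m‖ + 1)) (by positivity)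
  have e1 : m (θ ζ) = θ (m ζ) := congrArg (fun z : Op H => z ζ) (hθ m hm)
  have e2 : m (T ζ) - T (m ζ) = (θ (m ζ) - T (m ζ)) - m (θ ζ - T ζ) := by
    rw [map_sub, e1]; abel
  rw [e2]
  calc ‖(θ (m ζ) - T (m ζ)) - m (θ ζ - T ζ)‖
      ≤ ‖θ (m ζ) - T (m ζ)‖ + ‖m (θ ζ - T ζ)‖ := norm_sub_le _ _
    _ ≤ ε / (‖m‖ + 1) + ‖m‖ * (ε / (‖m‖ + 1)) := by
        gcongr
        exact (m.le_opNorm _).trans (by gcongr)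
    _ = 0 + ε := by field_simp; ring

end Final

/-- Let `N ⊆ M` be hyperfinite II₁ factors with `N' ∩ M = ℂ1` and let
`ω` be a free ultrafilter on ℕ with `M' ∩ M^ω ⊆ N^ω`. Then the central sequence
algebras coincide: `M' ∩ M^ω = N' ∩ N^ω` (inside `M^ω`). -/
theorem central_sequence_algebras_coincide
    {H : Type u} [NormedAddCommGroup H] [InnerProductSpace ℂ H] [CompleteSpace H]
    (ω : Ultrafilter ℕ) (hω : IsFreeUltrafilter ω)
    (M N Mω : VonNeumannAlgebra H) (τ : Op H →ₗ[ℂ] ℂ) (limω : (ℕ → Op H) → Op H)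
    (hM : IsII1Factor M τ) (hN : IsII1Factor N τ)
    (hMhf : IsHyperfinite M) (hNhf : IsHyperfinite N)
    (hNM : (N : Set (Op H)) ⊆ (M : Set (Op H)))
    (hirr : relComm (N : Set (Op H)) (M : Set (Op H)) = scalars H)
    (hU : IsTracialUltrapower ω M Mω τ limω)
    (hcs : relComm (M : Set (Op H)) (Mω : Set (Op H)) ⊆
      ultrapowerSet limω (N : Set (Op H))) :
    relComm (M : Set (Op H)) (Mω : Set (Op H)) =
      relComm (N : Set (Op H)) (ultrapowerSet limω (N : Set (Op H))) := by
  have h : (N : Set (Op H)) = (M : Set (Op H)) := by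
    refine Set.Subset.antisymm hNM fun x hx => ?_
    refine mem_of_comm N fun y hy => ?_
    exact (comm_of_mem M hx
      (centralizer_sub hω hU hM.factor hMhf hNhf hNM hirr hcs hy)).symm
  have h2 : ultrapowerSet limω (M : Set (Op H)) = (Mω : Set (Op H)) := by
    ext z
    refine ⟨?_, fun hz => hU.surj z hz⟩
    rintro ⟨x, hx, bx, rfl⟩
    exact hU.mem x hx bx
  rw [h, h2]

end PopaQ
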